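/- Assume the anti-concentration hypothesis: c̄ > 0, η > 0, k is a positive even integer, and the inlier matrices {A_i}_{i∈I} are k-certifiably (α²·η²·(1−2c̄)²/(32·c̄), 2c̄, 2M_x)-anti-concentrated. Fix ℓ ≥ k and let μ̃ be a level-ℓ pseudo-distribution in the variables (ω, x) satisfying M_{ω,x} at degree 0 such that ∑_{i=1}^n Ẽ_μ̃[ω_i] ≥ ∑_{i=1}^n Ẽ_ν[ω_i] for every level-ℓ pseudo-distribution ν satisfying M_{ω,x} at degree 0. Then the estimate x̂ satisfies ‖x̂ − x°‖ ≤ α·η·M_x/2 + 2·M_x·(1−α)/α. -/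

import Mathlib

open scoped BigOperators
open MvPolynomial

noncomputable section

/-- A polynomial is a sum of squares. -/
def IsSOS {V : Type*} (p : MvPolynomial V ℝ) : Prop :=
  ∃ (N : ℕ) (q : Fin N → MvPolynomial V ℝ), p = ∑ j, q j ^ 2

/-- A degree-`k` sum-of-squares proof that the system `{A i ≥ 0}` implies `g ≥ 0`:
a family of sos polynomials `P S`, indexed by the subsets `S` of the constraint
indices, with `g = ∑_S P S · ∏_{i∈S} A i` and every summand of degree at most `k`. -/
def SosProof {V ι : Type*} [Fintype ι] [DecidableEq ι]
    (A : ι → MvPolynomial V ℝ) (k : ℕ) (g : MvPolynomial V ℝ) : Prop :=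
  ∃ P : Finset ι → MvPolynomial V ℝ,
    (∀ S, IsSOS (P S)) ∧
    g = ∑ S : Finset ι, P S * ∏ i ∈ S, A i ∧
    ∀ S : Finset ι, (P S * ∏ i ∈ S, A i).totalDegree ≤ k

/-- Pseudo-expectation of `f` under the finitely supported `μ`. -/
def pExpect {V : Type*} (μ : (V → ℝ) →₀ ℝ) (f : (V → ℝ) → ℝ) : ℝ :=
  ∑ z ∈ μ.support, μ z * f z

/-- `μ` is a pseudo-distribution of level `ℓ`: finitely supported, total mass one,
and nonnegative pseudo-expectation on every square of a polynomial of degree `≤ ℓ/2`. -/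
def IsPseudoDist {V : Type*} (μ : (V → ℝ) →₀ ℝ) (ℓ : ℕ) : Prop :=
  (∑ z ∈ μ.support, μ z) = 1 ∧
  ∀ p : MvPolynomial V ℝ, p.totalDegree ≤ ℓ / 2 →
    0 ≤ pExpect μ fun z => MvPolynomial.eval z p ^ 2

/-- A level-`ℓ` pseudo-distribution `μ` satisfies the system `{A i ≥ 0}` at degree `k`. -/
def PDSatisfies {V ι : Type*} [Fintype ι] [DecidableEq ι]
    (μ : (V → ℝ) →₀ ℝ) (ℓ : ℕ) (A : ι → MvPolynomial V ℝ) (k : ℕ) : Prop :=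
  ∀ (S : Finset ι) (h : MvPolynomial V ℝ), IsSOS h →
    h.totalDegree + ∑ i ∈ S, max (A i).totalDegree k ≤ ℓ →
    0 ≤ pExpect μ fun z => MvPolynomial.eval z (h * ∏ i ∈ S, A i)

/-- Euclidean norm of a finite real vector. -/
def enorm {d : ℕ} (v : Fin d → ℝ) : ℝ := Real.sqrt (∑ k, v k ^ 2)

/-- The polynomial `‖A_iᵀ v‖²` in the indeterminate `v ∈ ℝ^{dx}`. -/
def normAPoly {n dx dy : ℕ} (A : Fin n → Matrix (Fin dx) (Fin dy) ℝ) (i : Fin n) :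
    MvPolynomial (Fin dx) ℝ :=
  ∑ j, (∑ k, C (A i k j) * X k) ^ 2

/-- The polynomial `‖v‖²` in the indeterminate `v ∈ ℝ^{dx}`. -/
def vnormPoly (dx : ℕ) : MvPolynomial (Fin dx) ℝ :=
  ∑ k, (X k : MvPolynomial (Fin dx) ℝ) ^ 2

/-- The matrices `{A_i}_{i∈I}` are `k`-certifiably `(Cc, δ, M)`-anti-concentrated:
there is an even univariate polynomial `p` with `p 0 = 1` (evenness witnessed by
`q` with `p(t) = q(t²)`) such that the two anti-concentration inequalities admit
degree-`k` sum-of-squares proofs; `p(‖A_iᵀ v‖)² = q(‖A_iᵀ v‖²)²` as a polynomial in `v`. -/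
def AntiConcentrated {n dx dy : ℕ} (A : Fin n → Matrix (Fin dx) (Fin dy) ℝ)
    (I : Finset (Fin n)) (k : ℕ) (Cc δ M : ℝ) : Prop :=
  ∃ p q : Polynomial ℝ,
    (∀ t : ℝ, p.eval t = q.eval (t ^ 2)) ∧ p.eval 0 = 1 ∧
    (∀ i ∈ I,
      SosProof (fun _ : Fin 1 => C (δ ^ 2) - normAPoly A i) k
        (Polynomial.aeval (normAPoly A i) q ^ 2 - C ((1 - δ) ^ 2))) ∧
    SosProof (fun _ : Fin 1 => C (M ^ 2) - vnormPoly dx) k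
      (C (Cc * δ * M ^ 2) -
        vnormPoly dx *
          (C ((I.card : ℝ)⁻¹) * ∑ i ∈ I, Polynomial.aeval (normAPoly A i) q ^ 2))

/-- The polynomial `‖y_i − A_iᵀ x‖²` in the variables `(ω, x)`. -/
def residPoly {n dx dy : ℕ} (y : Fin n → Fin dy → ℝ)
    (A : Fin n → Matrix (Fin dx) (Fin dy) ℝ) (i : Fin n) :
    MvPolynomial (Fin n ⊕ Fin dx) ℝ :=
  ∑ j, (C (y i j) - ∑ k, C (A i k j) * X (Sum.inr k)) ^ 2

/-- The system `M_{ω,x}`: `ω_i² = ω_i` (two inequalities each),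
`c̄² − ω_i·‖y_i − A_iᵀ x‖² ≥ 0`, and the inequalities `g_j(x) ≥ 0` describing `𝕏`. -/
def sysM {n dx dy mX : ℕ} (y : Fin n → Fin dy → ℝ)
    (A : Fin n → Matrix (Fin dx) (Fin dy) ℝ)
    (g : Fin mX → MvPolynomial (Fin dx) ℝ) (cbar : ℝ) :
    Fin n ⊕ Fin n ⊕ Fin n ⊕ Fin mX → MvPolynomial (Fin n ⊕ Fin dx) ℝ
  | Sum.inl i => X (Sum.inl i) - X (Sum.inl i) ^ 2
  | Sum.inr (Sum.inl i) => X (Sum.inl i) ^ 2 - X (Sum.inl i)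
  | Sum.inr (Sum.inr (Sum.inl i)) => C (cbar ^ 2) - X (Sum.inl i) * residPoly y A i
  | Sum.inr (Sum.inr (Sum.inr j)) => rename Sum.inr (g j)

/-- The system `T_{ω,x}`: `M_{ω,x}` together with `∑ ω_i = αn` (two inequalities). -/
def sysT {n dx dy mX : ℕ} (y : Fin n → Fin dy → ℝ)
    (A : Fin n → Matrix (Fin dx) (Fin dy) ℝ)
    (g : Fin mX → MvPolynomial (Fin dx) ℝ) (cbar α : ℝ) :
    Fin 2 ⊕ (Fin n ⊕ Fin n ⊕ Fin n ⊕ Fin mX) → MvPolynomial (Fin n ⊕ Fin dx) ℝ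
  | Sum.inl j =>
      if j = 0 then C (α * n) - ∑ i, X (Sum.inl i)
      else (∑ i, (X (Sum.inl i) : MvPolynomial (Fin n ⊕ Fin dx) ℝ)) - C (α * n)
  | Sum.inr e => sysM y A g cbar e

/-- The pseudo-expectation `Ẽ_μ[ω_i]`. -/
def Eω {n dx : ℕ} (μ : (Fin n ⊕ Fin dx → ℝ) →₀ ℝ) (i : Fin n) : ℝ :=
  pExpect μ fun z => z (Sum.inl i)

/-- The vector `v_i := Ẽ_μ[ω_i·x] / Ẽ_μ[ω_i]` if `Ẽ_μ[ω_i] > 0`, else `0`. -/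
def vEst {n dx : ℕ} (μ : (Fin n ⊕ Fin dx → ℝ) →₀ ℝ) (i : Fin n) : Fin dx → ℝ :=
  if 0 < Eω μ i then
    fun k => (Eω μ i)⁻¹ * pExpect μ fun z => z (Sum.inl i) * z (Sum.inr k)
  else 0

/-- The estimate `x̂ := ∑_i (Ẽ_μ[ω_i] / ∑_j Ẽ_μ[ω_j]) · v_i`. -/
def xhat {n dx : ℕ} (μ : (Fin n ⊕ Fin dx → ℝ) →₀ ℝ) : Fin dx → ℝ :=
  fun k => ∑ i, Eω μ i / (∑ j, Eω μ j) * vEst μ i k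

section IntervalPositivity

/-- A linear functional on univariate polynomials that is nonnegative, up to degree `D`, on
squares and on squares multiplied by `X`, `L - X` and `X (L - X)`. -/
structure IntervalFunctional (T : Polynomial ℝ →ₗ[ℝ] ℝ) (L : ℝ) (D : ℕ) : Prop where
  sq : ∀ f : Polynomial ℝ, 2 * f.natDegree ≤ D → 0 ≤ T (f ^ 2)
  left : ∀ f : Polynomial ℝ, 2 * f.natDegree + 1 ≤ D → 0 ≤ T (Polynomial.X * f ^ 2)
  right : ∀ f : Polynomial ℝ, 2 * f.natDegree + 1 ≤ D →
    0 ≤ T ((Polynomial.C L - Polynomial.X) * f ^ 2)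
  both : ∀ f : Polynomial ℝ, 2 * f.natDegree + 2 ≤ D →
    0 ≤ T (Polynomial.X * (Polynomial.C L - Polynomial.X) * f ^ 2)

/-- `T` is nonnegative on `r` times each of the generators of `IntervalFunctional`, as long as
the total degree stays below `D`. -/
structure PeelNonneg (T : Polynomial ℝ →ₗ[ℝ] ℝ) (L : ℝ) (D : ℕ) (r : Polynomial ℝ) :
    Prop where
  sq : ∀ f : Polynomial ℝ, 2 * f.natDegree + r.natDegree ≤ D → 0 ≤ T (f ^ 2 * r)
  left : ∀ f : Polynomial ℝ, 2 * f.natDegree + 1 + r.natDegree ≤ D →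
    0 ≤ T (Polynomial.X * f ^ 2 * r)
  right : ∀ f : Polynomial ℝ, 2 * f.natDegree + 1 + r.natDegree ≤ D →
    0 ≤ T ((Polynomial.C L - Polynomial.X) * f ^ 2 * r)
  both : ∀ f : Polynomial ℝ, 2 * f.natDegree + 2 + r.natDegree ≤ D →
    0 ≤ T (Polynomial.X * (Polynomial.C L - Polynomial.X) * f ^ 2 * r)

variable {T : Polynomial ℝ →ₗ[ℝ] ℝ} {L : ℝ} {D : ℕ}

lemma map_C_mul_eq (T : Polynomial ℝ →ₗ[ℝ] ℝ) (a : ℝ) (f : Polynomial ℝ) :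
    T (Polynomial.C a * f) = a * T f := by
  rw [← Polynomial.smul_eq_C_mul, map_smul, smul_eq_mul]

lemma natDegree_C_sub_X_le (L : ℝ) : (Polynomial.C L - Polynomial.X).natDegree ≤ 1 := by
  refine (Polynomial.natDegree_sub_le _ _).trans ?_
  simp

lemma IntervalFunctional.peelNonneg_C (hT : IntervalFunctional T L D) {a : ℝ} (ha : 0 ≤ a) :
    PeelNonneg T L D (Polynomial.C a) where
  sq f hf := by
    rw [mul_comm, map_C_mul_eq]
    exact mul_nonneg ha (hT.sq f (by omega))
  left f hf := by
    rw [mul_comm, map_C_mul_eq]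
    exact mul_nonneg ha (hT.left f (by omega))
  right f hf := by
    rw [mul_comm, map_C_mul_eq]
    exact mul_nonneg ha (hT.right f (by omega))
  both f hf := by
    rw [mul_comm, map_C_mul_eq]
    exact mul_nonneg ha (hT.both f (by omega))

lemma PeelNonneg.X_add_C_mul {r : Polynomial ℝ} (hr0 : r ≠ 0) (hr : PeelNonneg T L D r)
    {a : ℝ} (ha : 0 ≤ a) : PeelNonneg T L D ((Polynomial.X + Polynomial.C a) * r) := by
  have hdeg : ((Polynomial.X + Polynomial.C a) * r).natDegree = 1 + r.natDegree := by
    rw [Polynomial.natDegree_mul (Polynomial.X_add_C_ne_zero a) hr0,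
      Polynomial.natDegree_X_add_C]
  have hX : ∀ f : Polynomial ℝ, (Polynomial.X * f).natDegree ≤ 1 + f.natDegree := fun f =>
    Polynomial.natDegree_mul_le.trans (by simp)
  constructor <;> intro f hf <;> rw [hdeg] at hf
  · have e : f ^ 2 * ((Polynomial.X + Polynomial.C a) * r)
        = Polynomial.X * f ^ 2 * r + Polynomial.C a * (f ^ 2 * r) := by ring
    rw [e, map_add, map_C_mul_eq]
    exact add_nonneg (hr.left f (by omega)) (mul_nonneg ha (hr.sq f (by omega)))
  · have e : Polynomial.X * f ^ 2 * ((Polynomial.X + Polynomial.C a) * r)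
        = (Polynomial.X * f) ^ 2 * r + Polynomial.C a * (Polynomial.X * f ^ 2 * r) := by ring
    rw [e, map_add, map_C_mul_eq]
    have := hX f
    exact add_nonneg (hr.sq _ (by omega)) (mul_nonneg ha (hr.left f (by omega)))
  · have e : (Polynomial.C L - Polynomial.X) * f ^ 2 * ((Polynomial.X + Polynomial.C a) * r)
        = Polynomial.X * (Polynomial.C L - Polynomial.X) * f ^ 2 * r
          + Polynomial.C a * ((Polynomial.C L - Polynomial.X) * f ^ 2 * r) := by ring
    rw [e, map_add, map_C_mul_eq]
    exact add_nonneg (hr.both f (by omega)) (mul_nonneg ha (hr.right f (by omega)))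
  · have e : Polynomial.X * (Polynomial.C L - Polynomial.X) * f ^ 2
          * ((Polynomial.X + Polynomial.C a) * r)
        = (Polynomial.C L - Polynomial.X) * (Polynomial.X * f) ^ 2 * r
          + Polynomial.C a * (Polynomial.X * (Polynomial.C L - Polynomial.X) * f ^ 2 * r) := by
      ring
    rw [e, map_add, map_C_mul_eq]
    have := hX f
    exact add_nonneg (hr.right _ (by omega)) (mul_nonneg ha (hr.both f (by omega)))

lemma PeelNonneg.C_sub_X_mul {r : Polynomial ℝ} (hr0 : r ≠ 0) (hr : PeelNonneg T L D r)
    {a : ℝ} (ha : 0 ≤ a) :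
    PeelNonneg T L D ((Polynomial.C L - Polynomial.X + Polynomial.C a) * r) := by
  have e0 : Polynomial.C L - Polynomial.X + Polynomial.C a
      = -(Polynomial.X - Polynomial.C (L + a)) := by
    rw [Polynomial.C_add]; ring
  have hdeg : ((Polynomial.C L - Polynomial.X + Polynomial.C a) * r).natDegree
      = 1 + r.natDegree := by
    rw [e0, neg_mul, Polynomial.natDegree_neg,
      Polynomial.natDegree_mul (Polynomial.X_sub_C_ne_zero _) hr0, Polynomial.natDegree_X_sub_C]
  have hX : ∀ f : Polynomial ℝ,
      ((Polynomial.C L - Polynomial.X) * f).natDegree ≤ 1 + f.natDegree := fun f =>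
    Polynomial.natDegree_mul_le.trans (Nat.add_le_add_right (natDegree_C_sub_X_le L) _)
  constructor <;> intro f hf <;> rw [hdeg] at hf
  · have e : f ^ 2 * ((Polynomial.C L - Polynomial.X + Polynomial.C a) * r)
        = (Polynomial.C L - Polynomial.X) * f ^ 2 * r + Polynomial.C a * (f ^ 2 * r) := by ring
    rw [e, map_add, map_C_mul_eq]
    exact add_nonneg (hr.right f (by omega)) (mul_nonneg ha (hr.sq f (by omega)))
  · have e : Polynomial.X * f ^ 2 * ((Polynomial.C L - Polynomial.X + Polynomial.C a) * r)
        = Polynomial.X * (Polynomial.C L - Polynomial.X) * f ^ 2 * r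
          + Polynomial.C a * (Polynomial.X * f ^ 2 * r) := by ring
    rw [e, map_add, map_C_mul_eq]
    exact add_nonneg (hr.both _ (by omega)) (mul_nonneg ha (hr.left f (by omega)))
  · have e : (Polynomial.C L - Polynomial.X) * f ^ 2
          * ((Polynomial.C L - Polynomial.X + Polynomial.C a) * r)
        = ((Polynomial.C L - Polynomial.X) * f) ^ 2 * r
          + Polynomial.C a * ((Polynomial.C L - Polynomial.X) * f ^ 2 * r) := by ring
    rw [e, map_add, map_C_mul_eq]
    have := hX f
    exact add_nonneg (hr.sq _ (by omega)) (mul_nonneg ha (hr.right f (by omega)))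
  · have e : Polynomial.X * (Polynomial.C L - Polynomial.X) * f ^ 2
          * ((Polynomial.C L - Polynomial.X + Polynomial.C a) * r)
        = Polynomial.X * ((Polynomial.C L - Polynomial.X) * f) ^ 2 * r
          + Polynomial.C a * (Polynomial.X * (Polynomial.C L - Polynomial.X) * f ^ 2 * r) := by
      ring
    rw [e, map_add, map_C_mul_eq]
    have := hX f
    exact add_nonneg (hr.left _ (by omega)) (mul_nonneg ha (hr.both f (by omega)))

lemma PeelNonneg.sq_add_C_mul {r : Polynomial ℝ} (hr0 : r ≠ 0) (hr : PeelNonneg T L D r)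
    (a : ℝ) {b : ℝ} (hb : 0 ≤ b) :
    PeelNonneg T L D (((Polynomial.X - Polynomial.C a) ^ 2 + Polynomial.C b) * r) := by
  have hq : ((Polynomial.X - Polynomial.C a) ^ 2 + Polynomial.C b).natDegree = 2 := by
    rw [Polynomial.natDegree_add_C, Polynomial.natDegree_pow, Polynomial.natDegree_X_sub_C]
  have hdeg : (((Polynomial.X - Polynomial.C a) ^ 2 + Polynomial.C b) * r).natDegree
      = 2 + r.natDegree := by
    rw [Polynomial.natDegree_mul (fun h => by simp [h] at hq) hr0, hq]
  have hX : ∀ f : Polynomial ℝ,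
      ((Polynomial.X - Polynomial.C a) * f).natDegree ≤ 1 + f.natDegree := fun f =>
    Polynomial.natDegree_mul_le.trans (by rw [Polynomial.natDegree_X_sub_C])
  have key : ∀ (w f : Polynomial ℝ),
      T (w * f ^ 2 * (((Polynomial.X - Polynomial.C a) ^ 2 + Polynomial.C b) * r))
        = T (w * ((Polynomial.X - Polynomial.C a) * f) ^ 2 * r) + b * T (w * f ^ 2 * r) := by
    intro w f
    rw [← map_C_mul_eq, ← map_add]
    congr 1
    ring
  constructor <;> intro f hf <;> rw [hdeg] at hf <;> have := hX f
  · have h := key 1 f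
    simp only [one_mul] at h
    rw [h]
    exact add_nonneg (hr.sq _ (by omega)) (mul_nonneg hb (hr.sq f (by omega)))
  · rw [key]
    exact add_nonneg (hr.left _ (by omega)) (mul_nonneg hb (hr.left f (by omega)))
  · rw [key]
    exact add_nonneg (hr.right _ (by omega)) (mul_nonneg hb (hr.right f (by omega)))
  · rw [key]
    exact add_nonneg (hr.both _ (by omega)) (mul_nonneg hb (hr.both f (by omega)))

/-- A polynomial that is nonnegative on `[0, L]` away from one point is nonnegative on `[0, L]`. -/
lemma eval_nonneg_of_ne {L : ℝ} (hL : 0 < L) {r : Polynomial ℝ} (z : ℝ)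
    (h : ∀ s ∈ Set.Icc 0 L, s ≠ z → 0 ≤ r.eval s) : ∀ s ∈ Set.Icc 0 L, 0 ≤ r.eval s := by
  have hsub : Set.Ioo 0 L \ {z} ⊆ {s : ℝ | 0 ≤ r.eval s} := fun s hs =>
    h s ⟨hs.1.1.le, hs.1.2.le⟩ hs.2
  have hcl : IsClosed {s : ℝ | 0 ≤ r.eval s} := isClosed_le continuous_const r.continuous
  have hd : Dense ({z}ᶜ : Set ℝ) := dense_compl_singleton z
  intro s hs
  have h1 : s ∈ closure (Set.Ioo 0 L) := by rwa [closure_Ioo hL.ne]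
  have h2 : Set.Ioo 0 L ⊆ closure (Set.Ioo 0 L \ {z}) := by
    have := hd.open_subset_closure_inter (isOpen_Ioo (a := (0 : ℝ)) (b := L))
    rwa [← Set.sdiff_eq] at this
  have h3 := closure_minimal h2 isClosed_closure h1
  exact hcl.closure_subset_iff.2 hsub h3

/-- A functional that is nonnegative on the generators of the truncated preordering of `[0, L]`
is nonnegative on every polynomial of degree at most `D` that is nonnegative on `[0, L]`. -/
lemma IntervalFunctional.peelNonneg (hT : IntervalFunctional T L D) (hL : 0 < L)
    {r : Polynomial ℝ} (hr : r ≠ 0) (hpos : ∀ s ∈ Set.Icc 0 L, 0 ≤ r.eval s) :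
    PeelNonneg T L D r := by
  induction hN : r.natDegree using Nat.strong_induction_on generalizing r with
  | _ N ih =>
  subst hN
  rcases Nat.eq_zero_or_pos r.natDegree with h0 | h0
  · rw [Polynomial.eq_C_of_natDegree_eq_zero h0] at hpos ⊢
    have := hpos 0 ⟨le_rfl, hL.le⟩
    rw [Polynomial.eval_C] at this
    exact hT.peelNonneg_C this
  have hdegpos : 0 < (r.map (algebraMap ℝ ℂ)).degree := by
    rw [Polynomial.degree_map]
    exact Polynomial.natDegree_pos_iff_degree_pos.1 h0
  obtain ⟨z, hz⟩ := Complex.exists_root hdegpos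
  have hz' : Polynomial.aeval z r = 0 := by
    rwa [Polynomial.IsRoot, Polynomial.eval_map_algebraMap] at hz
  by_cases him : z.im = 0
  · have hroot : r.IsRoot z.re := by
      have hzre : z = algebraMap ℝ ℂ z.re := by
        apply Complex.ext <;> simp [him]
      rw [hzre, Polynomial.aeval_algebraMap_apply] at hz'
      simpa using hz'
    set x := z.re
    obtain ⟨r', rfl⟩ := Polynomial.dvd_iff_isRoot.2 hroot
    have hr' : r' ≠ 0 := right_ne_zero_of_mul hr
    have hdeg : ((Polynomial.X - Polynomial.C x) * r').natDegree = 1 + r'.natDegree := by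
      rw [Polynomial.natDegree_mul (Polynomial.X_sub_C_ne_zero _) hr', Polynomial.natDegree_X_sub_C]
    have hev : ∀ s ∈ Set.Icc 0 L, 0 ≤ (s - x) * r'.eval s := fun s hs => by
      have := hpos s hs
      simpa using this
    rcases le_or_gt x 0 with hx | hx
    · have hp : ∀ s ∈ Set.Icc 0 L, 0 ≤ r'.eval s := by
        refine eval_nonneg_of_ne hL x fun s hs hne => ?_
        have : 0 < s - x := lt_of_le_of_ne (by linarith [hs.1]) (sub_ne_zero.2 hne).symm
        exact nonneg_of_mul_nonneg_right (hev s hs) this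
      have := (ih _ (by omega) hr' hp rfl).X_add_C_mul hr' (a := -x) (by linarith)
      rwa [Polynomial.C_neg, ← sub_eq_add_neg] at this
    rcases le_or_gt L x with hxL | hxL
    · have hp : ∀ s ∈ Set.Icc 0 L, 0 ≤ (-r').eval s := by
        refine eval_nonneg_of_ne hL x fun s hs hne => ?_
        have : 0 < x - s := lt_of_le_of_ne (by linarith [hs.2]) (sub_ne_zero.2 hne.symm).symm
        refine nonneg_of_mul_nonneg_right ?_ this
        have := hev s hs
        rw [Polynomial.eval_neg]
        linarith
      have := (ih _ (by rw [Polynomial.natDegree_neg]; omega) (neg_ne_zero.2 hr') hp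
        rfl).C_sub_X_mul (neg_ne_zero.2 hr') (a := x - L) (by linarith)
      have e : (Polynomial.C L - Polynomial.X + Polynomial.C (x - L)) * -r'
          = (Polynomial.X - Polynomial.C x) * r' := by
        rw [Polynomial.C_sub]; ring
      rwa [e] at this
    · have hroot' : r'.IsRoot x := by
        have hcont : Continuous fun s => r'.eval s := r'.continuous
        rw [Polynomial.IsRoot]
        apply le_antisymm
        · have hcl : IsClosed {s : ℝ | r'.eval s ≤ 0} := isClosed_le hcont continuous_const
          have hsub : Set.Ioo 0 x ⊆ {s : ℝ | r'.eval s ≤ 0} := fun s hs => by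
            have h1 := hev s ⟨hs.1.le, by linarith [hs.2]⟩
            have h2 := hs.2
            by_contra hc
            rw [Set.mem_ofPred_eq, not_le] at hc
            nlinarith [mul_pos (sub_pos.2 h2) hc]
          have hx' : x ∈ closure (Set.Ioo 0 x) := by
            rw [closure_Ioo hx.ne]; exact ⟨hx.le, le_rfl⟩
          exact hcl.closure_subset_iff.2 hsub hx'
        · have hcl : IsClosed {s : ℝ | 0 ≤ r'.eval s} := isClosed_le continuous_const hcont
          have hsub : Set.Ioo x L ⊆ {s : ℝ | 0 ≤ r'.eval s} := fun s hs =>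
            nonneg_of_mul_nonneg_right (hev s ⟨by linarith [hs.1], hs.2.le⟩) (sub_pos.2 hs.1)
          have hx' : x ∈ closure (Set.Ioo x L) := by
            rw [closure_Ioo hxL.ne]; exact ⟨le_rfl, hxL.le⟩
          exact hcl.closure_subset_iff.2 hsub hx'
      obtain ⟨s', rfl⟩ := Polynomial.dvd_iff_isRoot.2 hroot'
      have hs' : s' ≠ 0 := right_ne_zero_of_mul hr'
      have hdeg' : ((Polynomial.X - Polynomial.C x) * s').natDegree = 1 + s'.natDegree := by
        rw [Polynomial.natDegree_mul (Polynomial.X_sub_C_ne_zero _) hs',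
          Polynomial.natDegree_X_sub_C]
      have hp : ∀ s ∈ Set.Icc 0 L, 0 ≤ s'.eval s := by
        refine eval_nonneg_of_ne hL x fun s hs hne => ?_
        have : 0 < (s - x) ^ 2 := by
          have := sub_ne_zero.2 hne
          positivity
        refine nonneg_of_mul_nonneg_right ?_ this
        have := hev s hs
        rw [Polynomial.eval_mul, Polynomial.eval_sub, Polynomial.eval_X, Polynomial.eval_C] at this
        linarith
      have := (ih _ (by omega) hs' hp rfl).sq_add_C_mul hs' x le_rfl
      rwa [Polynomial.C_0, add_zero, pow_two, mul_assoc] at this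
  · obtain ⟨r', rfl⟩ := Polynomial.quadratic_dvd_of_aeval_eq_zero_im_ne_zero r hz' him
    have e : Polynomial.X ^ 2 - Polynomial.C (2 * z.re) * Polynomial.X + Polynomial.C (‖z‖ ^ 2)
        = (Polynomial.X - Polynomial.C z.re) ^ 2 + Polynomial.C (z.im ^ 2) := by
      rw [Complex.sq_norm, Complex.normSq_apply]
      simp only [map_add, map_mul, map_pow, Polynomial.C_ofNat]
      ring
    rw [e] at hpos hr ih ⊢
    have hr' : r' ≠ 0 := right_ne_zero_of_mul hr
    have hq : ((Polynomial.X - Polynomial.C z.re) ^ 2 + Polynomial.C (z.im ^ 2)).natDegree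
        = 2 := by
      rw [Polynomial.natDegree_add_C, Polynomial.natDegree_pow, Polynomial.natDegree_X_sub_C]
    have hdeg : (((Polynomial.X - Polynomial.C z.re) ^ 2 + Polynomial.C (z.im ^ 2))
        * r').natDegree = 2 + r'.natDegree := by
      rw [Polynomial.natDegree_mul (left_ne_zero_of_mul hr) hr', hq]
    have hp : ∀ s ∈ Set.Icc 0 L, 0 ≤ r'.eval s := fun s hs => by
      have h1 := hpos s hs
      have h2 : 0 < (s - z.re) ^ 2 + z.im ^ 2 := by positivity
      refine nonneg_of_mul_nonneg_right ?_ h2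
      simpa using h1
    exact (ih _ (by omega) hr' hp rfl).sq_add_C_mul hr' z.re (sq_nonneg _)

lemma IntervalFunctional.nonneg (hT : IntervalFunctional T L D) (hL : 0 < L)
    {r : Polynomial ℝ} (hdeg : r.natDegree ≤ D) (hpos : ∀ s ∈ Set.Icc 0 L, 0 ≤ r.eval s) :
    0 ≤ T r := by
  by_cases hr : r = 0
  · simp [hr]
  have := (hT.peelNonneg hL hr hpos).sq 1 (by simpa using hdeg)
  simpa using this

end IntervalPositivity

section MeasurementFunctional

variable {σ : Type*} {dy : ℕ}

/-- A linear functional on polynomials satisfying the moment constraints of level `ℓ` attached to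
a single measurement with selector polynomial `O` and residual polynomials `ρ`. -/
structure MeasurementFunctional (E : MvPolynomial σ ℝ →ₗ[ℝ] ℝ) (ℓ : ℕ)
    (O : MvPolynomial σ ℝ) (ρ : Fin dy → MvPolynomial σ ℝ) (c : ℝ) : Prop where
  sq_nonneg : ∀ f : MvPolynomial σ ℝ, 2 * f.totalDegree ≤ ℓ → 0 ≤ E (f ^ 2)
  boolean : ∀ f : MvPolynomial σ ℝ, 2 * f.totalDegree + 2 ≤ ℓ → E (f ^ 2 * (O ^ 2 - O)) = 0
  resid : ∀ f : MvPolynomial σ ℝ, 2 * f.totalDegree + 3 ≤ ℓ →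
    0 ≤ E (f ^ 2 * (C (c ^ 2) - O * ∑ j, ρ j ^ 2))
  degree_selector : O.totalDegree ≤ 1
  degree_resid : ∀ j, (ρ j).totalDegree ≤ 1

lemma map_mvC_mul (E : MvPolynomial σ ℝ →ₗ[ℝ] ℝ) (a : ℝ) (f : MvPolynomial σ ℝ) :
    E (C a * f) = a * E f := by
  rw [← MvPolynomial.smul_eq_C_mul, map_smul, smul_eq_mul]

lemma totalDegree_add_le' {f g : MvPolynomial σ ℝ} {d : ℕ} (hf : f.totalDegree ≤ d)
    (hg : g.totalDegree ≤ d) : (f + g).totalDegree ≤ d :=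
  (totalDegree_add f g).trans (max_le hf hg)

lemma totalDegree_sub_le' {f g : MvPolynomial σ ℝ} {d : ℕ} (hf : f.totalDegree ≤ d)
    (hg : g.totalDegree ≤ d) : (f - g).totalDegree ≤ d :=
  (totalDegree_sub f g).trans (max_le hf hg)

lemma totalDegree_mul_le' {f g : MvPolynomial σ ℝ} {a b d : ℕ} (hf : f.totalDegree ≤ a)
    (hg : g.totalDegree ≤ b) (h : a + b ≤ d) : (f * g).totalDegree ≤ d :=
  (totalDegree_mul f g).trans ((add_le_add hf hg).trans h)

lemma totalDegree_C_le (a : ℝ) (d : ℕ) : (C a : MvPolynomial σ ℝ).totalDegree ≤ d := by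
  rw [totalDegree_C]; exact Nat.zero_le _

namespace MeasurementFunctional

variable {E : MvPolynomial σ ℝ →ₗ[ℝ] ℝ} {ℓ : ℕ} {O : MvPolynomial σ ℝ}
  {ρ : Fin dy → MvPolynomial σ ℝ} {c : ℝ}

lemma boolean_mul (h : MeasurementFunctional E ℓ O ρ c) {f g : MvPolynomial σ ℝ} {d : ℕ}
    (hf : f.totalDegree ≤ d) (hg : g.totalDegree ≤ d) (hd : 2 * d + 2 ≤ ℓ) :
    E (f * g * (O ^ 2 - O)) = 0 := by
  have h1 := h.boolean (f + g) (by have := totalDegree_add_le' hf hg; omega)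
  have h2 := h.boolean (f - g) (by have := totalDegree_sub_le' hf hg; omega)
  have e : C 4 * (f * g * (O ^ 2 - O))
      = (f + g) ^ 2 * (O ^ 2 - O) - (f - g) ^ 2 * (O ^ 2 - O) := by
    rw [map_ofNat]; ring
  have h3 := congrArg E e
  rw [map_mvC_mul, map_sub, h1, h2] at h3
  linarith

lemma selector_mul_sq_eq (h : MeasurementFunctional E ℓ O ρ c) {f : MvPolynomial σ ℝ} {d : ℕ}
    (hf : f.totalDegree ≤ d) (hd : 2 * d + 2 ≤ ℓ) : E (O * f ^ 2) = E ((O * f) ^ 2) := by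
  have h1 := h.boolean f (by omega)
  have e : f ^ 2 * (O ^ 2 - O) = (O * f) ^ 2 - O * f ^ 2 := by ring
  rw [e, map_sub] at h1
  linarith

lemma selector_mul_sq_nonneg (h : MeasurementFunctional E ℓ O ρ c) {f : MvPolynomial σ ℝ}
    {d : ℕ} (hf : f.totalDegree ≤ d) (hd : 2 * d + 2 ≤ ℓ) : 0 ≤ E (O * f ^ 2) := by
  rw [h.selector_mul_sq_eq hf hd]
  refine h.sq_nonneg _ ?_
  have := totalDegree_mul_le' h.degree_selector hf (le_refl (1 + d))
  omega

lemma map_selector_eq (h : MeasurementFunctional E ℓ O ρ c) (hℓ : 2 ≤ ℓ) :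
    E O = E (O ^ 2) := by
  have := h.selector_mul_sq_eq (f := 1) (d := 0) (by simp) (by omega)
  simpa using this

lemma map_selector_nonneg (h : MeasurementFunctional E ℓ O ρ c) (hℓ : 2 ≤ ℓ) : 0 ≤ E O := by
  rw [h.map_selector_eq hℓ]
  exact h.sq_nonneg _ (by have := h.degree_selector; omega)

lemma map_selector_le_one (h : MeasurementFunctional E ℓ O ρ c) (hE : E 1 = 1) (hℓ : 2 ≤ ℓ) :
    E O ≤ 1 := by
  have h1 := h.sq_nonneg (1 - O) (by
    have := totalDegree_sub_le' (d := 1) (by simp : (1 : MvPolynomial σ ℝ).totalDegree ≤ 1)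
      h.degree_selector
    omega)
  have e : (1 - O) ^ 2 = 1 - C 2 * O + O ^ 2 := by rw [map_ofNat]; ring
  rw [e, map_add, map_sub, map_mvC_mul, hE, ← h.map_selector_eq hℓ] at h1
  linarith

/-- Splitting a linear form in the residuals: if `L j + ρ j` is the constant `ε j` with
`∑ ε j ^ 2 ≤ c ^ 2`, then `∑ L j ^ 2 ≤ 2 ∑ ρ j ^ 2 + 2 c ^ 2` on selected measurements. -/
lemma selector_normSq_le (h : MeasurementFunctional E ℓ O ρ c) {ε : Fin dy → ℝ}
    (hε : ∑ j, ε j ^ 2 ≤ c ^ 2) {g : MvPolynomial σ ℝ} {d : ℕ} (hg : g.totalDegree ≤ d)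
    (hd : 2 * d + 4 ≤ ℓ) :
    E (O * g ^ 2 * ∑ j, (C (ε j) - ρ j) ^ 2)
      ≤ 2 * E (O * g ^ 2 * ∑ j, ρ j ^ 2) + 2 * c ^ 2 * E (O * g ^ 2) := by
  have h0 : 0 ≤ E (O * g ^ 2) := h.selector_mul_sq_nonneg hg (by omega)
  have h1 : 0 ≤ ∑ j, E (O * (g * (C (ε j) + ρ j)) ^ 2) := Finset.sum_nonneg fun j _ =>
    h.selector_mul_sq_nonneg (totalDegree_mul_le' hg
      (totalDegree_add_le' (totalDegree_C_le _ 1) (h.degree_resid j)) le_rfl) (by omega)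
  have e : ∑ j, O * (g * (C (ε j) + ρ j)) ^ 2
      = C 2 * (O * g ^ 2 * ∑ j, ρ j ^ 2) + C (2 * ∑ j, ε j ^ 2) * (O * g ^ 2)
        - O * g ^ 2 * ∑ j, (C (ε j) - ρ j) ^ 2 := by
    simp only [map_mul, map_ofNat, map_sum, map_pow, Finset.mul_sum, Finset.sum_mul,
      ← Finset.sum_add_distrib, ← Finset.sum_sub_distrib]
    refine Finset.sum_congr rfl fun j _ => ?_
    ring
  rw [← map_sum, e, map_sub, map_add, map_mvC_mul, map_mvC_mul] at h1
  nlinarith [mul_le_mul_of_nonneg_right hε h0]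

lemma selector_resid_le (h : MeasurementFunctional E ℓ O ρ c) {g : MvPolynomial σ ℝ} {d : ℕ}
    (hg : g.totalDegree ≤ d) (hd : 2 * d + 6 ≤ ℓ) :
    E (O * g ^ 2 * ∑ j, ρ j ^ 2) ≤ c ^ 2 * E (O * g ^ 2) := by
  have hOg : (O * g).totalDegree ≤ d + 1 :=
    totalDegree_mul_le' h.degree_selector hg (by omega)
  have h1 := h.resid (O * g) (by omega)
  have h2 : ∑ j, (E ((O * (g * ρ j)) * (g * ρ j) * (O ^ 2 - O))
      + E ((g * ρ j) * (g * ρ j) * (O ^ 2 - O))) = 0 := by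
    refine Finset.sum_eq_zero fun j _ => ?_
    have hgr : (g * ρ j).totalDegree ≤ d + 1 := totalDegree_mul_le' hg (h.degree_resid j) le_rfl
    rw [h.boolean_mul (d := d + 2) (totalDegree_mul_le' h.degree_selector hgr (by omega))
      (by omega) (by omega), h.boolean_mul hgr hgr (by omega), add_zero]
  have e : (O * g) ^ 2 * (C (c ^ 2) - O * ∑ j, ρ j ^ 2)
      = C (c ^ 2) * (O * g) ^ 2 - O * g ^ 2 * ∑ j, ρ j ^ 2
        - ∑ j, ((O * (g * ρ j)) * (g * ρ j) * (O ^ 2 - O)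
          + (g * ρ j) * (g * ρ j) * (O ^ 2 - O)) := by
    rw [mul_sub, mul_comm _ (C (c ^ 2)), sub_sub]
    congr 1
    simp only [Finset.mul_sum, ← Finset.sum_add_distrib]
    refine Finset.sum_congr rfl fun j _ => ?_
    ring
  rw [e, map_sub, map_sub, map_mvC_mul, map_sum, ← h.selector_mul_sq_eq hg (by omega)] at h1
  simp only [map_add] at h1
  linarith

/-- On a selected measurement, `∑ (ε j - ρ j) ^ 2 ≤ (2 c) ^ 2`. -/
lemma selector_normSq_le' (h : MeasurementFunctional E ℓ O ρ c) {ε : Fin dy → ℝ}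
    (hε : ∑ j, ε j ^ 2 ≤ c ^ 2) {g : MvPolynomial σ ℝ} {d : ℕ} (hg : g.totalDegree ≤ d)
    (hd : 2 * d + 6 ≤ ℓ) :
    E (O * g ^ 2 * ∑ j, (C (ε j) - ρ j) ^ 2) ≤ (2 * c) ^ 2 * E (O * g ^ 2) := by
  have h1 := h.selector_normSq_le hε hg (by omega)
  have h2 := h.selector_resid_le hg hd
  linarith

/-- The weighting `(Z - tO)²` loses only a constant multiple of `(1 - O) Z²`. -/
lemma selector_normSq_shift_le (h : MeasurementFunctional E ℓ O ρ c) {ε : Fin dy → ℝ}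
    (hε : ∑ j, ε j ^ 2 ≤ c ^ 2) {Z : MvPolynomial σ ℝ} (hZ : Z.totalDegree ≤ 1) (t : ℝ)
    (hℓ : 6 ≤ ℓ) :
    E (O * (Z - C t) ^ 2 * ∑ j, (C (ε j) - ρ j) ^ 2)
      ≤ (2 * c) ^ 2 * E (O * (Z - C t) ^ 2) + 2 * c ^ 2 * E ((1 - O) * Z ^ 2) := by
  have hg : (Z - C t).totalDegree ≤ 1 := totalDegree_sub_le' hZ (totalDegree_C_le _ _)
  have h1 := h.selector_normSq_le hε hg (by omega)
  have hshift : (Z - C t * O).totalDegree ≤ 1 :=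
    totalDegree_sub_le' hZ (totalDegree_mul_le' (totalDegree_C_le t 0) h.degree_selector le_rfl)
  have h2 := h.resid (Z - C t * O) (by omega)
  have hC : E (C (t ^ 2) * (1 * 1 * (O ^ 2 - O))) = 0 := by
    rw [map_mvC_mul, h.boolean_mul (d := 0) (by simp) (by simp) (by omega), mul_zero]
  have hR : ∑ j, (E (C (t ^ 2) * (ρ j * (O * ρ j) * (O ^ 2 - O)))
      + E (C (t ^ 2) * (ρ j * ρ j * (O ^ 2 - O)))
      - E (C (2 * t) * (ρ j * (Z * ρ j) * (O ^ 2 - O)))) = 0 := by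
    refine Finset.sum_eq_zero fun j _ => ?_
    have hr := h.degree_resid j
    have hr2 : (ρ j).totalDegree ≤ 2 := hr.trans (by norm_num)
    rw [map_mvC_mul, map_mvC_mul, map_mvC_mul,
      h.boolean_mul (d := 2) hr2 (totalDegree_mul_le' h.degree_selector hr le_rfl) (by omega),
      h.boolean_mul (d := 2) hr2 hr2 (by omega),
      h.boolean_mul (d := 2) hr2 (totalDegree_mul_le' hZ hr le_rfl) (by omega)]
    ring
  have e : (Z - C t * O) ^ 2 * (C (c ^ 2) - O * ∑ j, ρ j ^ 2)
      = C (c ^ 2) * (O * (Z - C t) ^ 2 + (1 - O) * Z ^ 2 + C (t ^ 2) * (1 * 1 * (O ^ 2 - O)))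
        - O * (Z - C t) ^ 2 * ∑ j, ρ j ^ 2
        - ∑ j, (C (t ^ 2) * (ρ j * (O * ρ j) * (O ^ 2 - O))
          + C (t ^ 2) * (ρ j * ρ j * (O ^ 2 - O))
          - C (2 * t) * (ρ j * (Z * ρ j) * (O ^ 2 - O))) := by
    rw [mul_sub, sub_sub]
    congr 1
    · simp only [map_pow]; ring
    simp only [Finset.mul_sum, ← Finset.sum_add_distrib, map_mul, map_pow, map_ofNat]
    refine Finset.sum_congr rfl fun j _ => ?_
    ring
  rw [e, map_sub, map_sub, map_mvC_mul, map_sum, map_add, map_add, hC] at h2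
  simp only [map_add, map_sub] at h2 hR
  rw [hR] at h2
  linarith

end MeasurementFunctional

end MeasurementFunctional

section PerMeasurement

variable {σ : Type*} {dy : ℕ}

lemma totalDegree_aeval_le {N : MvPolynomial σ ℝ} {e : ℕ} (hN : N.totalDegree ≤ e)
    (f : Polynomial ℝ) : (Polynomial.aeval N f).totalDegree ≤ e * f.natDegree := by
  rw [Polynomial.aeval_eq_sum_range]
  refine totalDegree_finsetSum_le fun i hi => ?_
  refine (totalDegree_smul_le _ _).trans ((totalDegree_pow _ _).trans ?_)
  rw [mul_comm e]
  exact Nat.mul_le_mul (Nat.lt_succ_iff.mp (Finset.mem_range.mp hi)) hN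

namespace MeasurementFunctional

variable {E : MvPolynomial σ ℝ →ₗ[ℝ] ℝ} {ℓ : ℕ} {O : MvPolynomial σ ℝ}
  {ρ : Fin dy → MvPolynomial σ ℝ} {c : ℝ} {ε : Fin dy → ℝ} {z : MvPolynomial σ ℝ}

lemma degree_form (h : MeasurementFunctional E ℓ O ρ c) (ε : Fin dy → ℝ) (j : Fin dy) :
    (C (ε j) - ρ j).totalDegree ≤ 1 :=
  totalDegree_sub_le' (totalDegree_C_le _ _) (h.degree_resid j)

lemma degree_normSq (h : MeasurementFunctional E ℓ O ρ c) (ε : Fin dy → ℝ) :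
    (∑ j, (C (ε j) - ρ j) ^ 2).totalDegree ≤ 2 :=
  totalDegree_finsetSum_le fun j _ => (totalDegree_pow _ _).trans
    (by have := h.degree_form ε j; omega)

/-- If the functional dominates `κ² O z²` then `O z` is controlled by `B / κ` on average. -/
lemma selector_linear_le (h : MeasurementFunctional E ℓ O ρ c) (hE : E 1 = 1)
    (hz : z.totalDegree ≤ 1) (hℓ : 4 ≤ ℓ) (κ B : ℝ) :
    2 * B * κ * E (O * z) ≤ κ ^ 2 * E (O * z ^ 2) + B ^ 2 := by
  have h1 := h.selector_mul_sq_nonneg (f := C κ * z - C B) (d := 1)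
    (totalDegree_sub_le' (totalDegree_mul_le' (totalDegree_C_le κ 0) hz le_rfl)
      (totalDegree_C_le _ _)) (by omega)
  have e : O * (C κ * z - C B) ^ 2
      = C (κ ^ 2) * (O * z ^ 2) - C (2 * B * κ) * (O * z) + C (B ^ 2) * O := by
    simp only [map_mul, map_pow, map_ofNat]; ring
  rw [e, map_add, map_sub, map_mvC_mul, map_mvC_mul, map_mvC_mul] at h1
  nlinarith [h.map_selector_le_one hE (by omega), pow_two_nonneg B]

/-- A polynomial weight `p` dominating `κ` on `O z²` dominates `κ² O z²` after squaring. -/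
lemma sq_weight_ge (h : MeasurementFunctional E ℓ O ρ c) (hz : z.totalDegree ≤ 1)
    {p : MvPolynomial σ ℝ} {d : ℕ} (hp : p.totalDegree ≤ d) (hd1 : 1 ≤ d)
    (hd : 2 * d + 2 ≤ ℓ) {κ : ℝ} (hκ : 0 ≤ κ)
    (hpκ : κ * E (O * z ^ 2) ≤ E (O * z ^ 2 * p)) :
    κ ^ 2 * E (O * z ^ 2) ≤ E (p ^ 2 * z ^ 2) := by
  have hOz : (O * z).totalDegree ≤ 2 := totalDegree_mul_le' h.degree_selector hz le_rfl
  have h1 := h.sq_nonneg (p * z - C κ * (O * z)) (by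
    have := totalDegree_sub_le' (totalDegree_mul_le' hp hz (le_refl (d + 1)))
      (totalDegree_mul_le' (totalDegree_C_le κ 0) hOz (by omega : 0 + 2 ≤ d + 1))
    omega)
  have e : (p * z - C κ * (O * z)) ^ 2
      = p ^ 2 * z ^ 2 - C (2 * κ) * (O * z ^ 2 * p) + C (κ ^ 2) * (O * z) ^ 2 := by
    simp only [map_mul, map_pow, map_ofNat]; ring
  rw [e, map_add, map_sub, map_mvC_mul, map_mvC_mul,
    ← h.selector_mul_sq_eq hz (by omega)] at h1
  nlinarith

/-- Univariate positivity transfers to the measurement functional. -/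
lemma intervalFunctional (h : MeasurementFunctional E ℓ O ρ c)
    (hε : ∑ j, ε j ^ 2 ≤ c ^ 2) (hz : z.totalDegree ≤ 1) {m : ℕ} (hm : 2 ≤ m)
    (hℓ : 4 * m + 2 ≤ ℓ) :
    IntervalFunctional (E ∘ₗ LinearMap.mulLeft ℝ (O * z ^ 2) ∘ₗ
      (Polynomial.aeval (∑ j, (C (ε j) - ρ j) ^ 2)).toLinearMap) ((2 * c) ^ 2) m := by
  set N := ∑ j, (C (ε j) - ρ j) ^ 2 with hN
  have hzf : ∀ f : Polynomial ℝ, (z * Polynomial.aeval N f).totalDegree ≤ 2 * f.natDegree + 1 :=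
    fun f => totalDegree_mul_le' hz (totalDegree_aeval_le (h.degree_normSq ε) f) (by omega)
  have hLzf : ∀ (f : Polynomial ℝ) (j : Fin dy),
      ((C (ε j) - ρ j) * (z * Polynomial.aeval N f)).totalDegree ≤ 2 * f.natDegree + 2 :=
    fun f j => totalDegree_mul_le' (h.degree_form ε j) (hzf f) (by omega)
  have split : ∀ P : MvPolynomial σ ℝ,
      O * P ^ 2 * N = ∑ j, O * ((C (ε j) - ρ j) * P) ^ 2 := by
    intro P
    rw [hN, Finset.mul_sum]
    exact Finset.sum_congr rfl fun j _ => by ring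
  constructor
  · intro f hf
    have e : O * z ^ 2 * Polynomial.aeval N (f ^ 2) = O * (z * Polynomial.aeval N f) ^ 2 := by
      rw [map_pow]; ring
    simp only [LinearMap.comp_apply, LinearMap.mulLeft_apply, AlgHom.toLinearMap_apply, e]
    exact h.selector_mul_sq_nonneg (hzf f) (by omega)
  · intro f hf
    have e : O * z ^ 2 * Polynomial.aeval N (Polynomial.X * f ^ 2)
        = O * (z * Polynomial.aeval N f) ^ 2 * N := by
      rw [map_mul, map_pow, Polynomial.aeval_X]; ring
    simp only [LinearMap.comp_apply, LinearMap.mulLeft_apply, AlgHom.toLinearMap_apply, e]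
    rw [split, map_sum]
    exact Finset.sum_nonneg fun j _ => h.selector_mul_sq_nonneg (hLzf f j) (by omega)
  · intro f hf
    have e : O * z ^ 2 *
          Polynomial.aeval N ((Polynomial.C ((2 * c) ^ 2) - Polynomial.X) * f ^ 2)
        = C ((2 * c) ^ 2) * (O * (z * Polynomial.aeval N f) ^ 2)
          - O * (z * Polynomial.aeval N f) ^ 2 * N := by
      rw [map_mul, map_sub, map_pow (Polynomial.aeval N) f, Polynomial.aeval_X, Polynomial.aeval_C, algebraMap_eq]
      ring
    simp only [LinearMap.comp_apply, LinearMap.mulLeft_apply, AlgHom.toLinearMap_apply, e]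
    rw [map_sub, map_mvC_mul]
    exact sub_nonneg.mpr (h.selector_normSq_le' hε (hzf f) (by omega))
  · intro f hf
    have e : O * z ^ 2 * Polynomial.aeval N
          (Polynomial.X * (Polynomial.C ((2 * c) ^ 2) - Polynomial.X) * f ^ 2)
        = ∑ j, (C ((2 * c) ^ 2) * (O * ((C (ε j) - ρ j) * (z * Polynomial.aeval N f)) ^ 2)
          - O * ((C (ε j) - ρ j) * (z * Polynomial.aeval N f)) ^ 2 * N) := by
      rw [Finset.sum_sub_distrib, ← Finset.mul_sum, ← Finset.sum_mul, ← split]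
      rw [map_mul, map_mul, map_sub, map_pow (Polynomial.aeval N) f, Polynomial.aeval_X, Polynomial.aeval_C,
        algebraMap_eq]
      ring
    simp only [LinearMap.comp_apply, LinearMap.mulLeft_apply, AlgHom.toLinearMap_apply, e]
    rw [map_sum]
    refine Finset.sum_nonneg fun j _ => ?_
    rw [map_sub, map_mvC_mul]
    exact sub_nonneg.mpr (h.selector_normSq_le' hε (hLzf f j) (by omega))

/-- The estimate for a weight polynomial of degree at least two. -/
lemma selector_linear_le_of_two_le (h : MeasurementFunctional E ℓ O ρ c) (hE : E 1 = 1)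
    (hc : 0 < c) (hε : ∑ j, ε j ^ 2 ≤ c ^ 2) (hz : z.totalDegree ≤ 1) {q : Polynomial ℝ}
    (hm : 2 ≤ q.natDegree) (hℓ : 4 * q.natDegree + 2 ≤ ℓ) {κ : ℝ} (hκ : 0 ≤ κ)
    (hq : ∀ s ∈ Set.Icc 0 ((2 * c) ^ 2), κ ≤ q.eval s) (B : ℝ) :
    2 * B * κ * E (O * z)
      ≤ E (Polynomial.aeval (∑ j, (C (ε j) - ρ j) ^ 2) q ^ 2 * z ^ 2) + B ^ 2 := by
  have h1 := (h.intervalFunctional hε hz hm hℓ).nonneg (by positivity)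
    (r := q - Polynomial.C κ) (by rw [Polynomial.natDegree_sub_C]) (fun s hs => by
      simpa using hq s hs)
  simp only [LinearMap.comp_apply, LinearMap.mulLeft_apply, AlgHom.toLinearMap_apply, map_sub,
    Polynomial.aeval_C, algebraMap_eq, mul_comm _ (C κ), map_mvC_mul] at h1
  have h2 := h.sq_weight_ge hz (totalDegree_aeval_le (h.degree_normSq ε) q) (by omega) (by omega)
    hκ (by linarith)
  linarith [h.selector_linear_le hE hz (by omega) κ B]

/-- The estimate for the constant weight. -/
lemma selector_linear_le_of_const (h : MeasurementFunctional E ℓ O ρ c) (hE : E 1 = 1)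
    (hz : z.totalDegree ≤ 1) (hℓ : 2 ≤ ℓ) (B : ℝ) :
    2 * B * E (O * z) ≤ E (z ^ 2) + B ^ 2 := by
  have h1 := h.sq_nonneg (z - C B * O) (by
    have := totalDegree_sub_le' hz
      (totalDegree_mul_le' (totalDegree_C_le B 0) h.degree_selector le_rfl)
    omega)
  have e : (z - C B * O) ^ 2 = z ^ 2 - C (2 * B) * (O * z) + C (B ^ 2) * O ^ 2 := by
    simp only [map_mul, map_pow, map_ofNat]; ring
  rw [e, map_add, map_sub, map_mvC_mul, map_mvC_mul, ← h.map_selector_eq hℓ] at h1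
  nlinarith [h.map_selector_le_one hE (by omega), pow_two_nonneg B]

lemma selector_normSq_nonneg (h : MeasurementFunctional E ℓ O ρ c) (ε : Fin dy → ℝ)
    {P : MvPolynomial σ ℝ} (hP : P.totalDegree ≤ 1) (hℓ : 6 ≤ ℓ) :
    0 ≤ E (O * P ^ 2 * ∑ j, (C (ε j) - ρ j) ^ 2) := by
  have e : O * P ^ 2 * ∑ j, (C (ε j) - ρ j) ^ 2 = ∑ j, O * ((C (ε j) - ρ j) * P) ^ 2 := by
    rw [Finset.mul_sum]
    exact Finset.sum_congr rfl fun j _ => by ring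
  rw [e, map_sum]
  exact Finset.sum_nonneg fun j _ => h.selector_mul_sq_nonneg
    (totalDegree_mul_le' (h.degree_form ε j) hP le_rfl) (by omega)

/-- The estimate for an increasing affine weight. -/
lemma selector_linear_le_of_affine_incr (h : MeasurementFunctional E ℓ O ρ c) (hE : E 1 = 1)
    (ε : Fin dy → ℝ) (hz : z.totalDegree ≤ 1) (hℓ : 6 ≤ ℓ) {b : ℝ} (hb : 0 ≤ b) (B : ℝ) :
    2 * B * E (O * z) ≤ E ((1 + C b * ∑ j, (C (ε j) - ρ j) ^ 2) ^ 2 * z ^ 2) + B ^ 2 := by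
  have h0 := mul_nonneg hb (h.selector_normSq_nonneg ε hz hℓ)
  have hp : (1 + C b * ∑ j, (C (ε j) - ρ j) ^ 2).totalDegree ≤ 2 :=
    totalDegree_add_le' (by simp)
      (totalDegree_mul_le' (totalDegree_C_le b 0) (h.degree_normSq ε) le_rfl)
  have h2 := h.sq_weight_ge hz hp (by omega) (by omega) zero_le_one (by
    have e : O * z ^ 2 * (1 + C b * ∑ j, (C (ε j) - ρ j) ^ 2)
        = O * z ^ 2 + C b * (O * z ^ 2 * ∑ j, (C (ε j) - ρ j) ^ 2) := by ring
    rw [e, map_add, map_mvC_mul]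
    linarith)
  have := h.selector_linear_le hE hz (by omega) 1 B
  linarith

/-- The numerical parameter used for decreasing affine weights. -/
lemma exists_affine_parameter {c : ℝ} (h0 : 0 < c) (h1 : c < 1) :
    ∃ r : ℝ, 0 < r ∧ 9 * c * (1 - c) * r ^ 2 ≤ 4 ∧
      0 ≤ c ^ 2 * (1 - (2 - r) ^ 2) - (1 - c) * c * (2 - r) ^ 2 / 2 := by
  rcases le_or_gt c (1 / 5) with h | h
  · refine ⟨2 / (1 + c), by positivity, ?_, ?_⟩
    · rw [div_pow, mul_div_assoc', div_le_iff₀ (by positivity)]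
      nlinarith
    · have e : 2 - 2 / (1 + c) = 2 * c / (1 + c) := by field_simp; ring
      have e2 : c ^ 2 * (1 - (2 * c / (1 + c)) ^ 2) - (1 - c) * c * (2 * c / (1 + c)) ^ 2 / 2
          = c ^ 2 * (1 - c) / (1 + c) := by
        field_simp; ring
      rw [e, e2]
      have : 0 < 1 - c := by linarith
      positivity
  rcases le_or_gt c (2 / 7) with h' | h'
  · exact ⟨22 / 15, by norm_num, by nlinarith, by nlinarith⟩
  · exact ⟨4 / 3, by norm_num, by nlinarith [pow_two_nonneg (2 * c - 1)], by nlinarith⟩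

/-- Normalised form of the estimate for a decreasing affine weight `1 - κ N`. -/
lemma selector_linear_le_of_affine_decr_aux (h : MeasurementFunctional E ℓ O ρ c)
    (hE : E 1 = 1) (hε : ∑ j, ε j ^ 2 ≤ c ^ 2) {Z : MvPolynomial σ ℝ}
    (hZ : Z.totalDegree ≤ 1) (hℓ : 6 ≤ ℓ) {κ d : ℝ} (hκ : 0 ≤ κ) (hd0 : 0 < d) (hd1 : d < 1)
    (hd : κ * (2 * c) ^ 2 = 1 - d) (hZ2 : E ((1 - O) * Z ^ 2) ≤ 9 * d ^ 2 * (1 - E O)) :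
    2 * d ^ 2 * E (O * Z)
      ≤ E ((1 - C κ * ∑ j, (C (ε j) - ρ j) ^ 2) ^ 2 * Z ^ 2) + d ^ 2 := by
  obtain ⟨r, hr, hr1, hr2⟩ := exists_affine_parameter hd0 hd1
  set N := ∑ j, (C (ε j) - ρ j) ^ 2 with hN
  have hNdeg : N.totalDegree ≤ 2 := h.degree_normSq ε
  have hO := h.degree_selector
  have h1deg : (1 : MvPolynomial σ ℝ).totalDegree = 0 := totalDegree_one
  set β : MvPolynomial σ ℝ := C (d * (r - 2)) + C (d * (1 - r)) * Z with hβ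
  have hβdeg : β.totalDegree ≤ 1 := totalDegree_add_le' (totalDegree_C_le _ _)
    (totalDegree_mul_le' (totalDegree_C_le _ 0) hZ le_rfl)
  have hZ1 : (Z - 1).totalDegree ≤ 1 := totalDegree_sub_le' hZ (by omega)
  set t := (r - 2) / r with ht
  set a := d * r ^ 2 / 2 with ha
  obtain ⟨w, hw⟩ : ∃ w, w = d ^ 2 * (1 - (2 - r) ^ 2) - (1 - d) * d * (2 - r) ^ 2 / 2 :=
    ⟨_, rfl⟩
  rw [← hw] at hr2
  have hsq := h.sq_nonneg ((1 - C κ * N) * Z + O * β) (by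
    have hpZ : ((1 - C κ * N) * Z).totalDegree ≤ 3 :=
      totalDegree_mul_le' (totalDegree_sub_le' (by omega)
        (totalDegree_mul_le' (totalDegree_C_le κ 0) hNdeg le_rfl)) hZ le_rfl
    have := totalDegree_add_le' hpZ (totalDegree_mul_le' hO hβdeg (by omega : 1 + 1 ≤ 3))
    omega)
  have hbool := h.boolean_mul (d := 1) hβdeg hβdeg (by omega)
  have hNZ := h.selector_normSq_nonneg ε hZ1 hℓ
  have hOZ := h.selector_mul_sq_nonneg hZ1 (by omega)
  have hshift := h.selector_normSq_shift_le hε hZ t hℓ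
  rw [← hN] at hNZ hshift
  have ident : (1 - C κ * N) ^ 2 * Z ^ 2
      = C (2 * d ^ 2) * (O * Z) - C (d ^ 2) * O
        + ((1 - C κ * N) * Z + O * β) ^ 2 - β * β * (O ^ 2 - O)
        + C (a * t ^ 2 * κ) * (O * (Z - 1) ^ 2 * N)
        + C w * (O * (Z - 1) ^ 2)
        - C (a * κ) * (O * (Z - C t) ^ 2 * N)
        + C (a * (1 - d)) * (O * (Z - C t) ^ 2) := by
    clear_value N
    refine MvPolynomial.funext fun x => ?_
    simp only [map_add, map_sub, map_mul, map_pow, map_one, eval_C, hβ, ht, ha, hw]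
    field_simp
    ring
  have hI := congrArg E ident
  simp only [map_add, map_sub, map_mvC_mul] at hI
  have hap : 0 ≤ a := by positivity
  have h1 := mul_nonneg (mul_nonneg (mul_nonneg hap (pow_two_nonneg t)) hκ) hNZ
  have h2 := mul_nonneg hr2 hOZ
  have h3 := mul_le_mul_of_nonneg_left hshift (mul_nonneg hap hκ)
  have hEO : 0 ≤ 1 - E O := sub_nonneg.mpr (h.map_selector_le_one hE (by omega))
  have h4 := mul_le_mul_of_nonneg_left hZ2
    (mul_nonneg hap (by linarith : (0 : ℝ) ≤ (1 - d) / 2))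
  have h5 : a * ((1 - d) / 2) * (9 * d ^ 2 * (1 - E O)) ≤ d ^ 2 * (1 - E O) := by
    have : 9 * a * (1 - d) ≤ 2 := by rw [ha]; linarith
    nlinarith [mul_nonneg (pow_two_nonneg d) hEO]
  have h6 : a * κ * (2 * c) ^ 2 = a * (1 - d) := by rw [← hd]; ring
  have h7 : a * κ * (2 * c ^ 2) = a * ((1 - d) / 2) := by rw [← hd]; ring
  rw [mul_add, ← mul_assoc, ← mul_assoc, h6, h7] at h3
  linarith

/-- The estimate for a decreasing affine weight `1 - κ N`. -/
lemma selector_linear_le_of_affine_decr (h : MeasurementFunctional E ℓ O ρ c)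
    (hE : E 1 = 1) (hε : ∑ j, ε j ^ 2 ≤ c ^ 2) (hz : z.totalDegree ≤ 1) (hℓ : 6 ≤ ℓ)
    {κ d B M : ℝ} (hκ : 0 ≤ κ) (hd0 : 0 < d) (hd1 : d < 1)
    (hd : κ * (2 * c) ^ 2 = 1 - d) (hB : 0 < B) (hM : M ^ 2 ≤ 9 * B ^ 2)
    (hz2 : E ((1 - O) * z ^ 2) ≤ M ^ 2 * (1 - E O)) :
    2 * B * d * E (O * z)
      ≤ E ((1 - C κ * ∑ j, (C (ε j) - ρ j) ^ 2) ^ 2 * z ^ 2) + B ^ 2 := by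
  have hEO : 0 ≤ 1 - E O := sub_nonneg.mpr (h.map_selector_le_one hE (by omega))
  have e1 : (1 - O) * (C (d / B) * z) ^ 2 = C ((d / B) ^ 2) * ((1 - O) * z ^ 2) := by
    rw [map_pow]; ring
  have h1 := h.selector_linear_le_of_affine_decr_aux hE hε (Z := C (d / B) * z)
    (totalDegree_mul_le' (totalDegree_C_le _ 0) hz le_rfl) hℓ hκ hd0 hd1 hd (by
      rw [e1, map_mvC_mul]
      calc (d / B) ^ 2 * E ((1 - O) * z ^ 2) ≤ (d / B) ^ 2 * (9 * B ^ 2 * (1 - E O)) :=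
            mul_le_mul_of_nonneg_left
              (hz2.trans (mul_le_mul_of_nonneg_right hM hEO)) (by positivity)
        _ = 9 * d ^ 2 * (1 - E O) := by field_simp)
  have e2 : O * (C (d / B) * z) = C (d / B) * (O * z) := by ring
  have e3 : ∀ p : MvPolynomial σ ℝ, p * (C (d / B) * z) ^ 2 = C ((d / B) ^ 2) * (p * z ^ 2) :=
    fun p => by rw [map_pow]; ring
  rw [e2, e3, map_mvC_mul, map_mvC_mul] at h1
  have h2 := mul_le_mul_of_nonneg_left h1 (by positivity : 0 ≤ (B / d) ^ 2)
  have e4 : (B / d) ^ 2 * (2 * d ^ 2 * (d / B * E (O * z))) = 2 * B * d * E (O * z) := by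
    field_simp
  have e5 : ∀ x : ℝ, (B / d) ^ 2 * ((d / B) ^ 2 * x + d ^ 2) = x + B ^ 2 := fun x => by
    field_simp
  rw [e4, e5] at h2
  exact h2

end MeasurementFunctional

end PerMeasurement

section UniformEstimate

variable {σ : Type*} {dy : ℕ}

/-- Uniform per-measurement estimate: the constant `d` depends only on the weight `q`. -/
lemma exists_uniform_selector_bound {E : MvPolynomial σ ℝ →ₗ[ℝ] ℝ} {ℓ : ℕ} (hE : E 1 = 1)
    {c : ℝ} (hc : 0 < c) {q : Polynomial ℝ} (hq0 : q.eval 0 = 1) (hℓ : 2 ≤ ℓ)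
    (hdeg : q.natDegree ≠ 0 → 4 * q.natDegree + 2 ≤ ℓ) {κ B M : ℝ} (hκ : 0 < κ)
    (hq : ∀ s ∈ Set.Icc 0 ((2 * c) ^ 2), κ ≤ q.eval s) (hB : 0 < B)
    (hM : q.natDegree ≤ 1 → M ^ 2 ≤ 9 * B ^ 2) :
    ∃ d, κ ≤ d ∧ ∀ (O : MvPolynomial σ ℝ) (ρ : Fin dy → MvPolynomial σ ℝ) (ε : Fin dy → ℝ)
      (z : MvPolynomial σ ℝ), MeasurementFunctional E ℓ O ρ c → ∑ j, ε j ^ 2 ≤ c ^ 2 →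
      z.totalDegree ≤ 1 → (4 ≤ ℓ → E ((1 - O) * z ^ 2) ≤ M ^ 2 * (1 - E O)) →
      2 * B * d * E (O * z)
        ≤ E (Polynomial.aeval (∑ j, (C (ε j) - ρ j) ^ 2) q ^ 2 * z ^ 2) + B ^ 2 := by
  have hκ1 : κ ≤ 1 := hq0 ▸ hq 0 ⟨le_rfl, by positivity⟩
  rcases Nat.lt_or_ge q.natDegree 2 with hlt | h2
  · have hqe : q = Polynomial.C 1 + Polynomial.C (q.coeff 1) * Polynomial.X := by
      have h := Polynomial.eq_X_add_C_of_natDegree_le_one (p := q) (by omega)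
      have h0 : q.coeff 0 = 1 := by rw [Polynomial.coeff_zero_eq_eval_zero, hq0]
      rw [h0] at h
      rw [add_comm]
      exact h
    have hae : ∀ N : MvPolynomial σ ℝ, Polynomial.aeval N q = 1 + C (q.coeff 1) * N := by
      intro N
      conv_lhs => rw [hqe]
      simp [algebraMap_eq]
    by_cases hm0 : q.natDegree = 0
    · have hb : q.coeff 1 = 0 := Polynomial.coeff_eq_zero_of_natDegree_lt (by omega)
      refine ⟨1, hκ1, fun O ρ ε z h _ hz _ => ?_⟩
      rw [hae, hb, map_zero, zero_mul, add_zero, one_pow, one_mul, mul_one]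
      exact h.selector_linear_le_of_const hE hz hℓ B
    have hℓ6 : 6 ≤ ℓ := by have := hdeg hm0; omega
    rcases le_or_gt 0 (q.coeff 1) with hb | hb
    · refine ⟨1, hκ1, fun O ρ ε z h _ hz _ => ?_⟩
      rw [hae, mul_one]
      exact h.selector_linear_le_of_affine_incr hE ε hz hℓ6 hb B
    · have hev : q.eval ((2 * c) ^ 2) = 1 + q.coeff 1 * (2 * c) ^ 2 := by
        conv_lhs => rw [hqe]
        simp
      have hκd : κ ≤ 1 + q.coeff 1 * (2 * c) ^ 2 :=
        hev ▸ hq _ ⟨by positivity, le_rfl⟩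
      refine ⟨_, hκd, fun O ρ ε z h hε hz hz2 => ?_⟩
      have hneg : q.coeff 1 * (2 * c) ^ 2 < 0 := mul_neg_of_neg_of_pos hb (by positivity)
      have := h.selector_linear_le_of_affine_decr hE hε hz hℓ6 (κ := -q.coeff 1)
        (d := 1 + q.coeff 1 * (2 * c) ^ 2) (by linarith) (by linarith) (by linarith) (by ring)
        hB (hM (by omega)) (hz2 (by omega))
      rw [hae]
      rwa [map_neg, neg_mul, sub_neg_eq_add] at this
  · exact ⟨κ, le_rfl, fun O ρ ε z h hε hz _ =>
      h.selector_linear_le_of_two_le hE hc hε hz h2 (hdeg (by omega)) hκ.le hq B⟩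

end UniformEstimate

section Certificates

lemma IsSOS.eval_nonneg {V : Type*} {p : MvPolynomial V ℝ} (hp : IsSOS p) (x : V → ℝ) :
    0 ≤ eval x p := by
  obtain ⟨N, q, rfl⟩ := hp
  rw [map_sum]
  exact Finset.sum_nonneg fun j _ => by rw [map_pow]; positivity

lemma SosProof.eval_nonneg {V ι : Type*} [Fintype ι] [DecidableEq ι]
    {A : ι → MvPolynomial V ℝ} {k : ℕ} {g : MvPolynomial V ℝ} (h : SosProof A k g)
    {x : V → ℝ} (hx : ∀ i, 0 ≤ eval x (A i)) : 0 ≤ eval x g := by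
  obtain ⟨P, hP, rfl, -⟩ := h
  rw [map_sum]
  refine Finset.sum_nonneg fun S _ => ?_
  rw [map_mul, map_prod]
  exact mul_nonneg ((hP S).eval_nonneg x) (Finset.prod_nonneg fun i _ => hx i)

lemma SosProof.totalDegree_le {V ι : Type*} [Fintype ι] [DecidableEq ι]
    {A : ι → MvPolynomial V ℝ} {k : ℕ} {g : MvPolynomial V ℝ} (h : SosProof A k g) :
    g.totalDegree ≤ k := by
  obtain ⟨P, -, rfl, hd⟩ := h
  exact totalDegree_finsetSum_le fun S _ => hd S

lemma eval_aeval_eq {V : Type*} (x : V → ℝ) (N : MvPolynomial V ℝ) (q : Polynomial ℝ) :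
    eval x (Polynomial.aeval N q) = q.eval (eval x N) := by
  rw [Polynomial.aeval_def, Polynomial.hom_eval₂, Polynomial.eval]
  congr 1
  ext
  simp

variable {n dx dy : ℕ} {A : Fin n → Matrix (Fin dx) (Fin dy) ℝ} {I : Finset (Fin n)}

lemma eval_normAPoly (i : Fin n) (x : Fin dx → ℝ) :
    eval x (normAPoly A i) = ∑ j, (∑ k, A i k j * x k) ^ 2 := by
  simp [normAPoly]

lemma eval_normAPoly_nonneg (i : Fin n) (x : Fin dx → ℝ) : 0 ≤ eval x (normAPoly A i) := by
  rw [eval_normAPoly]; positivity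

lemma eval_normAPoly_smul (i : Fin n) (t : ℝ) (x : Fin dx → ℝ) :
    eval (fun k => t * x k) (normAPoly A i) = t ^ 2 * eval x (normAPoly A i) := by
  simp only [eval_normAPoly, Finset.mul_sum]
  refine Finset.sum_congr rfl fun j _ => ?_
  rw [← mul_pow, Finset.mul_sum]
  congr 1
  exact Finset.sum_congr rfl fun k _ => by ring

lemma eval_vnormPoly (x : Fin dx → ℝ) : eval x (vnormPoly dx) = ∑ k, x k ^ 2 := by
  simp [vnormPoly]

/-- Lower bound on the weight polynomial over the certified interval. -/
lemma weight_ge_of_certificate {q : Polynomial ℝ} (hq0 : q.eval 0 = 1) {δ : ℝ} (hδ : δ ≠ 1)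
    {k : ℕ} {i : Fin n} {x : Fin dx → ℝ} (hx : 0 < eval x (normAPoly A i))
    (hcert : SosProof (fun _ : Fin 1 => C (δ ^ 2) - normAPoly A i) k
      (Polynomial.aeval (normAPoly A i) q ^ 2 - C ((1 - δ) ^ 2))) :
    ∀ s ∈ Set.Icc 0 (δ ^ 2), |1 - δ| ≤ q.eval s := by
  have hpos : 0 < |1 - δ| := abs_pos.mpr (sub_ne_zero.mpr hδ.symm)
  have hsq : ∀ s ∈ Set.Icc 0 (δ ^ 2), (1 - δ) ^ 2 ≤ q.eval s ^ 2 := by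
    intro s hs
    set a := eval x (normAPoly A i)
    have hv : eval (fun k => Real.sqrt (s / a) * x k) (normAPoly A i) = s := by
      rw [eval_normAPoly_smul, Real.sq_sqrt (div_nonneg hs.1 hx.le)]
      exact div_mul_cancel₀ _ hx.ne'
    have h := hcert.eval_nonneg (x := fun k => Real.sqrt (s / a) * x k) (fun _ => by
      rw [map_sub, eval_C, hv]; linarith [hs.2])
    rw [map_sub, map_pow, eval_aeval_eq, eval_C, hv] at h
    linarith
  intro s hs
  by_contra! hlt
  have h1 := sq_le_sq.mp (hsq s hs)
  have hneg : q.eval s ≤ 0 := by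
    by_contra! hp
    rw [abs_of_pos hp] at h1
    linarith
  obtain ⟨r, hr, hr0⟩ := intermediate_value_Icc' hs.1 q.continuous.continuousOn
    (show (0 : ℝ) ∈ Set.Icc (q.eval s) (q.eval 0) from ⟨hneg, by rw [hq0]; norm_num⟩)
  have h2 := hsq r ⟨hr.1, hr.2.trans hs.2⟩
  simp only at hr0
  rw [hr0, ← sq_abs] at h2
  nlinarith

/-- Evaluation of the averaged anti-concentration certificate. -/
lemma average_le_of_certificate {q : Polynomial ℝ} {K M : ℝ} {k : ℕ}
    (hcert : SosProof (fun _ : Fin 1 => C (M ^ 2) - vnormPoly dx) k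
      (C K - vnormPoly dx *
          (C ((I.card : ℝ)⁻¹) * ∑ i ∈ I, Polynomial.aeval (normAPoly A i) q ^ 2)))
    (x : Fin dx → ℝ) (t : ℝ) (ht : t ^ 2 * ∑ k, x k ^ 2 ≤ M ^ 2) :
    t ^ 2 * (∑ k, x k ^ 2) *
      ((I.card : ℝ)⁻¹ * ∑ i ∈ I, q.eval (t ^ 2 * eval x (normAPoly A i)) ^ 2) ≤ K := by
  have hn : eval (fun k => t * x k) (vnormPoly dx) = t ^ 2 * ∑ k, x k ^ 2 := by
    rw [eval_vnormPoly, Finset.mul_sum]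
    exact Finset.sum_congr rfl fun k _ => by ring
  have h := hcert.eval_nonneg (x := fun k => t * x k) (fun _ => by
    rw [map_sub, eval_C, hn]; linarith)
  simp only [map_sub, map_mul, map_sum, map_pow, eval_C, eval_aeval_eq, hn,
    eval_normAPoly_smul] at h
  linarith

lemma certificate_const_pos {q : Polynomial ℝ} (hq0 : q.eval 0 = 1) {K M : ℝ} (hM : 0 < M)
    {k : ℕ} (hI : I.Nonempty) (hdx : 0 < dx)
    (hcert : SosProof (fun _ : Fin 1 => C (M ^ 2) - vnormPoly dx) k
      (C K - vnormPoly dx *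
          (C ((I.card : ℝ)⁻¹) * ∑ i ∈ I, Polynomial.aeval (normAPoly A i) q ^ 2))) :
    0 < K := by
  have hcard : (0 : ℝ) < I.card := by exact_mod_cast hI.card_pos
  set x : Fin dx → ℝ := fun _ => 1
  have hx : 0 < ∑ k, x k ^ 2 := by simp [x, hdx]
  obtain ⟨i, hi⟩ := hI
  set a := eval x (normAPoly A i)
  have hcont : Continuous fun t : ℝ => q.eval (t ^ 2 * a) :=
    q.continuous.comp (by fun_prop)
  have h1 : ∀ᶠ t in nhds (0 : ℝ), 0 < q.eval (t ^ 2 * a) :=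
    hcont.continuousAt.eventually_const_lt (by simp [hq0])
  have h2 : ∀ᶠ t in nhds (0 : ℝ), t ^ 2 * ∑ k, x k ^ 2 < M ^ 2 :=
    (by fun_prop : Continuous fun t : ℝ => t ^ 2 * ∑ k, x k ^ 2).continuousAt.eventually_lt_const
      (by simpa using pow_pos hM 2)
  obtain ⟨t, ⟨ht1, ht2⟩, ht0⟩ :=
    (((h1.and h2).filter_mono nhdsWithin_le_nhds).and
      (self_mem_nhdsWithin : ∀ᶠ t in nhdsWithin (0 : ℝ) (Set.Ioi 0), t ∈ Set.Ioi (0 : ℝ))).exists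
  have ht0' : 0 < t := ht0
  refine lt_of_lt_of_le ?_ (average_le_of_certificate hcert x t ht2.le)
  have h3 : 0 < ∑ i ∈ I, q.eval (t ^ 2 * eval x (normAPoly A i)) ^ 2 :=
    lt_of_lt_of_le (pow_pos ht1 2)
      (Finset.single_le_sum (f := fun i => q.eval (t ^ 2 * eval x (normAPoly A i)) ^ 2)
        (fun j _ => pow_two_nonneg _) hi)
  exact mul_pos (mul_pos (pow_pos ht0' 2) hx) (mul_pos (inv_pos.mpr hcard) h3)

/-- For affine weights the certified constant is at least a fixed fraction of the radius. -/
lemma radius_le_of_affine {q : Polynomial ℝ} (hq0 : q.eval 0 = 1) (hq1 : q.natDegree ≤ 1)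
    {B M : ℝ} (hB : 0 ≤ B) (hM : 0 < M) {k : ℕ} (hI : I.Nonempty) (hdx : 0 < dx)
    (hcert : SosProof (fun _ : Fin 1 => C (M ^ 2) - vnormPoly dx) k
      (C (B ^ 2) - vnormPoly dx *
          (C ((I.card : ℝ)⁻¹) * ∑ i ∈ I, Polynomial.aeval (normAPoly A i) q ^ 2))) :
    M ^ 2 ≤ 9 * B ^ 2 := by
  have hcard : (0 : ℝ) < I.card := by exact_mod_cast hI.card_pos
  set x : Fin dx → ℝ := fun _ => 1
  have hx : 0 < ∑ k, x k ^ 2 := by simp [x, hdx]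
  set X2 := ∑ k, x k ^ 2
  have heval : ∀ s, q.eval s = 1 + q.coeff 1 * s := by
    intro s
    have h := Polynomial.eq_X_add_C_of_natDegree_le_one hq1
    have h0 : q.coeff 0 = 1 := by rw [Polynomial.coeff_zero_eq_eval_zero, hq0]
    rw [h0] at h
    conv_lhs => rw [h]
    simp [add_comm]
  set m := (I.card : ℝ)⁻¹ * ∑ i ∈ I, q.coeff 1 * eval x (normAPoly A i) with hm
  have jensen : ∀ t : ℝ, t ^ 2 * X2 ≤ M ^ 2 → t ^ 2 * X2 * (1 + t ^ 2 * m) ^ 2 ≤ B ^ 2 := by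
    intro t ht
    refine le_trans ?_ (average_le_of_certificate hcert x t ht)
    refine mul_le_mul_of_nonneg_left ?_ (by positivity)
    have hcs := sq_sum_le_card_mul_sum_sq (s := I)
      (f := fun i => q.eval (t ^ 2 * eval x (normAPoly A i)))
    have e : ∑ i ∈ I, q.eval (t ^ 2 * eval x (normAPoly A i)) = I.card * (1 + t ^ 2 * m) := by
      simp only [heval, Finset.sum_add_distrib, Finset.sum_const, nsmul_eq_mul, hm]
      rw [mul_add, mul_left_comm _ (t ^ 2), mul_inv_cancel_left₀ hcard.ne', Finset.mul_sum]
      congr 1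
      exact Finset.sum_congr rfl fun i _ => by ring
    rw [e] at hcs
    rw [← div_eq_inv_mul, le_div_iff₀ hcard]
    nlinarith
  obtain ⟨t, ht⟩ : ∃ t : ℝ, t ^ 2 * X2 = M ^ 2 := ⟨M / Real.sqrt X2, by
    rw [div_pow, Real.sq_sqrt hx.le, div_mul_cancel₀ _ hx.ne']⟩
  have h1 := jensen t ht.le
  have h2 := jensen (t / 2) (by nlinarith [pow_two_nonneg M])
  have e2 : (t / 2) ^ 2 * X2 = (M / 2) ^ 2 := by rw [div_pow, div_pow, ← ht]; ring
  have e3 : (t / 2) ^ 2 * m = t ^ 2 * m / 4 := by ring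
  rw [ht, ← mul_pow] at h1
  rw [e2, e3, ← mul_pow] at h2
  have h1' := abs_le_of_sq_le_sq' h1 hB
  have h2' := abs_le_of_sq_le_sq' h2 hB
  have : M ≤ 3 * B := by nlinarith [h1'.1, h2'.2]
  nlinarith

/-- The weight polynomial of a certified system has small degree. -/
lemma degree_le_of_certificate {q : Polynomial ℝ} (hq : q.natDegree ≠ 0) {K M : ℝ} {k : ℕ}
    {i : Fin n} (hi : i ∈ I) {x : Fin dx → ℝ} (hx : 0 < eval x (normAPoly A i))
    (hcert : SosProof (fun _ : Fin 1 => C (M ^ 2) - vnormPoly dx) k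
      (C K - vnormPoly dx *
          (C ((I.card : ℝ)⁻¹) * ∑ i ∈ I, Polynomial.aeval (normAPoly A i) q ^ 2))) :
    4 * q.natDegree + 2 ≤ k := by
  by_contra! hlt
  have hcard : (0 : ℝ) < I.card := by exact_mod_cast Finset.card_pos.mpr ⟨i, hi⟩
  set m := q.natDegree with hm
  set line : Fin dx → Polynomial ℝ := fun l => Polynomial.C (x l) * Polynomial.X with hline
  have hdeg := MvPolynomial.aeval_natDegree_le (m := k) (n := 1) _ hcert.totalDegree_le line
    (fun l => ((Polynomial.natDegree_C_mul_le _ _).trans Polynomial.natDegree_X_le))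
  have hz := Polynomial.coeff_eq_zero_of_natDegree_lt
    (lt_of_le_of_lt hdeg (by omega : k * 1 < 4 * m + 2))
  set f : Fin n → Polynomial ℝ := fun i =>
    Polynomial.expand ℝ 2 (q.comp (Polynomial.C (eval x (normAPoly A i)) * Polynomial.X)) with hf
  have hN : ∀ i, MvPolynomial.aeval line (normAPoly A i)
      = Polynomial.C (eval x (normAPoly A i)) * Polynomial.X ^ 2 := by
    intro i
    rw [eval_normAPoly, normAPoly]
    simp only [map_sum, map_pow, map_mul, aeval_X, aeval_C, hline, Finset.sum_mul,
      Polynomial.algebraMap_eq]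
    refine Finset.sum_congr rfl fun j _ => ?_
    rw [← mul_pow, Finset.sum_mul]
    congr 1
    exact Finset.sum_congr rfl fun l _ => by ring
  have hNq : ∀ i, MvPolynomial.aeval line (Polynomial.aeval (normAPoly A i) q) = f i := by
    intro i
    rw [← Polynomial.aeval_algHom_apply, hN, hf]
    simp only [Polynomial.expand_eq_comp_X_pow, Polynomial.comp_assoc, Polynomial.mul_comp,
      Polynomial.C_comp, Polynomial.X_comp]
    rfl
  have hv : MvPolynomial.aeval line (vnormPoly dx)
      = Polynomial.C (∑ l, x l ^ 2) * Polynomial.X ^ 2 := by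
    simp only [vnormPoly, map_sum, map_pow, aeval_X, hline, Finset.sum_mul, mul_pow]
  have hfdeg : ∀ i, (f i).natDegree ≤ 2 * m := by
    intro i
    rw [hf, Polynomial.natDegree_expand, mul_comm]
    refine Nat.mul_le_mul_left 2 (Polynomial.natDegree_comp_le.trans ?_)
    exact (Nat.mul_le_mul_left _ ((Polynomial.natDegree_C_mul_le _ _).trans Polynomial.natDegree_X_le)).trans (by omega)
  have hfc : ∀ i, (f i ^ 2).coeff (4 * m)
      = (q.leadingCoeff * eval x (normAPoly A i) ^ m) ^ 2 := by
    intro i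
    have h1 := Polynomial.coeff_pow_of_natDegree_le (m := 2) (hfdeg i)
    rw [show 4 * m = 2 * (2 * m) by ring, h1, hf]
    simp only []
    rw [mul_comm 2 m, Polynomial.coeff_expand_mul (by norm_num), Polynomial.comp_C_mul_X_coeff,
      Polynomial.leadingCoeff]
  have hX : 0 < ∑ l, x l ^ 2 := by
    by_contra! h0
    have h0' : ∀ l, x l = 0 := fun l => by
      have := (Finset.sum_eq_zero_iff_of_nonneg (fun l _ => pow_two_nonneg (x l))).mp
        (le_antisymm h0 (Finset.sum_nonneg fun l _ => pow_two_nonneg (x l))) l (Finset.mem_univ l)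
      exact pow_eq_zero_iff (two_ne_zero) |>.mp this
    rw [eval_normAPoly] at hx
    simp [h0'] at hx
  have hlead : q.leadingCoeff ≠ 0 := by
    intro h
    rw [Polynomial.leadingCoeff_eq_zero] at h
    exact hq (by rw [hm, h, Polynomial.natDegree_zero])
  rw [map_sub, map_mul, map_mul, map_sum, hv, aeval_C, aeval_C] at hz
  simp only [map_pow, hNq] at hz
  rw [Polynomial.coeff_sub, Polynomial.algebraMap_eq, Polynomial.coeff_C_of_ne_zero (by omega),
    mul_right_comm, Polynomial.coeff_mul_X_pow] at hz
  simp only [Polynomial.coeff_C_mul, Polynomial.finsetSum_coeff, hfc] at hz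
  have hs : 0 < ∑ j ∈ I, (q.leadingCoeff * eval x (normAPoly A j) ^ m) ^ 2 :=
    lt_of_lt_of_le (pow_two_pos_of_ne_zero (mul_ne_zero hlead (pow_ne_zero m hx.ne')))
      (Finset.single_le_sum (f := fun j => (q.leadingCoeff * eval x (normAPoly A j) ^ m) ^ 2)
        (fun j _ => pow_two_nonneg _) hi)
  have : 0 < (∑ l, x l ^ 2) * ((I.card : ℝ)⁻¹ *
      ∑ j ∈ I, (q.leadingCoeff * eval x (normAPoly A j) ^ m) ^ 2) :=
    mul_pos hX (mul_pos (inv_pos.mpr hcard) hs)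
  linarith

end Certificates

section PseudoExpectation

variable {V : Type*}

/-- The pseudo-expectation as a linear functional on polynomials. -/
def expectation (μ : (V → ℝ) →₀ ℝ) : MvPolynomial V ℝ →ₗ[ℝ] ℝ :=
  ∑ z ∈ μ.support, μ z • (MvPolynomial.aeval (R := ℝ) z).toLinearMap

lemma expectation_apply (μ : (V → ℝ) →₀ ℝ) (f : MvPolynomial V ℝ) :
    expectation μ f = pExpect μ fun z => eval z f := by
  simp [expectation, pExpect, MvPolynomial.aeval_eq_eval]

lemma isSOS_sq (f : MvPolynomial V ℝ) : IsSOS (f ^ 2) :=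
  ⟨1, fun _ => f, by simp⟩

lemma IsSOS.mul_sq {h : MvPolynomial V ℝ} (hh : IsSOS h) (f : MvPolynomial V ℝ) :
    IsSOS (h * f ^ 2) := by
  obtain ⟨N, q, rfl⟩ := hh
  exact ⟨N, fun j => q j * f, by simp only [Finset.sum_mul, mul_pow]⟩

lemma IsSOS.aeval {W : Type*} {h : MvPolynomial V ℝ} (hh : IsSOS h)
    (v : V → MvPolynomial W ℝ) : IsSOS (MvPolynomial.aeval v h) := by
  obtain ⟨N, q, rfl⟩ := hh
  exact ⟨N, fun j => MvPolynomial.aeval v (q j), by simp only [map_sum, map_pow]⟩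

lemma totalDegree_aeval_le_of_degree_le_one {W : Type*} {v : V → MvPolynomial W ℝ}
    (hv : ∀ k, (v k).totalDegree ≤ 1) (f : MvPolynomial V ℝ) :
    (MvPolynomial.aeval v f).totalDegree ≤ f.totalDegree := by
  rw [MvPolynomial.aeval_def, MvPolynomial.eval₂_eq]
  refine totalDegree_finsetSum_le fun d hd => ?_
  refine (totalDegree_mul _ _).trans ?_
  rw [MvPolynomial.algebraMap_eq, totalDegree_C, zero_add]
  refine (totalDegree_finsetProd _ _).trans ?_
  refine le_trans (Finset.sum_le_sum fun k _ => ?_) (le_totalDegree hd)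
  exact (totalDegree_pow _ _).trans ((Nat.mul_le_mul_left _ (hv k)).trans (mul_one _).le)

lemma totalDegree_sub_vnormPoly {dx : ℕ} (hdx : 0 < dx) (M : ℝ) :
    2 ≤ (C (M ^ 2) - vnormPoly dx).totalDegree := by
  classical
  set k : Fin dx := ⟨0, hdx⟩
  have hc : (C (M ^ 2) - vnormPoly dx).coeff (Finsupp.single k 2) = -1 := by
    rw [coeff_sub, coeff_C, vnormPoly, coeff_sum]
    rw [if_neg (by
      intro h
      have := DFunLike.congr_fun h k
      simp at this)]
    simp only [X_pow_eq_monomial, coeff_monomial]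
    rw [Finset.sum_eq_single k]
    · simp
    · intro b _ hb
      rw [if_neg]
      intro h
      exact hb (Finsupp.single_left_injective (by norm_num) h)
    · simp
  have h := le_totalDegree (p := C (M ^ 2) - vnormPoly dx) (s := Finsupp.single k 2)
    (by rw [mem_support_iff, hc]; norm_num)
  simpa using h

/-- Moment positivity on the ball of radius `M` for the polynomials `v`. -/
structure BallFunctional {dx : ℕ} (E : MvPolynomial V ℝ →ₗ[ℝ] ℝ) (ℓ : ℕ)
    (v : Fin dx → MvPolynomial V ℝ) (M : ℝ) : Prop where
  sos_nonneg : ∀ h : MvPolynomial V ℝ, IsSOS h → h.totalDegree ≤ ℓ → 0 ≤ E h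
  ball : ∀ h : MvPolynomial V ℝ, IsSOS h → h.totalDegree + 2 ≤ ℓ →
    0 ≤ E (h * (C (M ^ 2) - ∑ k, v k ^ 2))
  degree_le : ∀ k, (v k).totalDegree ≤ 1

namespace BallFunctional

variable {dx : ℕ} {E : MvPolynomial V ℝ →ₗ[ℝ] ℝ} {ℓ : ℕ} {v : Fin dx → MvPolynomial V ℝ} {M : ℝ}

lemma sosProof_nonneg (h : BallFunctional E ℓ v M) (hdx : 0 < dx) {k : ℕ} (hk : k ≤ ℓ)
    {g : MvPolynomial (Fin dx) ℝ}
    (hg : SosProof (fun _ : Fin 1 => C (M ^ 2) - vnormPoly dx) k g) :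
    0 ≤ E (MvPolynomial.aeval v g) := by
  obtain ⟨P, hP, rfl, hd⟩ := hg
  rw [map_sum, map_sum]
  refine Finset.sum_nonneg fun S _ => ?_
  have hdeg := hd S
  have haev := totalDegree_aeval_le_of_degree_le_one h.degree_le (P S)
  rw [Finset.prod_const] at hdeg ⊢
  rcases Nat.lt_or_ge S.card 1 with h0 | h1
  · rw [Nat.lt_one_iff.mp h0, pow_zero, mul_one] at hdeg ⊢
    exact h.sos_nonneg _ ((hP S).aeval v) (by omega)
  · have h1' : S.card = 1 := le_antisymm (by simpa using Finset.card_le_univ S) h1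
    rw [h1', pow_one] at hdeg ⊢
    by_cases hPS : P S = 0
    · simp [hPS]
    have h2 := totalDegree_sub_vnormPoly hdx M
    rw [totalDegree_mul_of_isDomain hPS (by intro h; rw [h] at h2; simp at h2)] at hdeg
    have := h.ball _ ((hP S).aeval v) (by omega)
    simpa [vnormPoly, MvPolynomial.algebraMap_eq] using this

/-- A unit direction carries at most the full squared norm. -/
lemma direction_le (h : BallFunctional E ℓ v M) {u : Fin dx → ℝ} (hu : ∑ k, u k ^ 2 = 1)
    {f : MvPolynomial V ℝ} (hf : 2 * (f.totalDegree + 1) ≤ ℓ) :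
    E (f ^ 2 * (∑ k, C (u k) * v k) ^ 2) ≤ E (f ^ 2 * ∑ k, v k ^ 2) := by
  set z := ∑ k, C (u k) * v k with hz
  have hzdeg : z.totalDegree ≤ 1 := totalDegree_finsetSum_le fun k _ =>
    totalDegree_mul_le' (totalDegree_C_le _ 0) (h.degree_le k) le_rfl
  have e : f ^ 2 * ∑ k, v k ^ 2 - f ^ 2 * z ^ 2 = ∑ k, (f * (v k - C (u k) * z)) ^ 2 := by
    have e1 : ∀ k, (f * (v k - C (u k) * z)) ^ 2
        = f ^ 2 * v k ^ 2 - 2 * f ^ 2 * z * (C (u k) * v k) + f ^ 2 * z ^ 2 * C (u k ^ 2) := by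
      intro k
      rw [map_pow]; ring
    simp only [e1, Finset.sum_add_distrib, Finset.sum_sub_distrib, ← Finset.mul_sum, ← map_sum]
    rw [hu, ← hz, map_one]
    ring
  have h1 : 0 ≤ E (∑ k, (f * (v k - C (u k) * z)) ^ 2) := by
    rw [map_sum]
    refine Finset.sum_nonneg fun k _ => h.sos_nonneg _ (isSOS_sq _) ?_
    have h2 : (f * (v k - C (u k) * z)).totalDegree ≤ f.totalDegree + 1 :=
      totalDegree_mul_le' le_rfl (totalDegree_sub_le' (h.degree_le k)
        (totalDegree_mul_le' (totalDegree_C_le _ 0) hzdeg le_rfl)) le_rfl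
    refine (totalDegree_pow _ _).trans ?_
    omega
  rw [← e, map_sub] at h1
  linarith

lemma direction_le_radius (h : BallFunctional E ℓ v M) {u : Fin dx → ℝ}
    (hu : ∑ k, u k ^ 2 = 1) {f : MvPolynomial V ℝ} (hf : 2 * (f.totalDegree + 1) ≤ ℓ) :
    E (f ^ 2 * (∑ k, C (u k) * v k) ^ 2) ≤ M ^ 2 * E (f ^ 2) := by
  refine (h.direction_le hu hf).trans ?_
  have h1 := h.ball _ (isSOS_sq f) (by have := totalDegree_pow f 2; omega)
  rw [mul_sub, map_sub, mul_comm _ (C (M ^ 2)), map_mvC_mul] at h1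
  linarith

end BallFunctional

end PseudoExpectation

section MeasurementSystem

variable {n dx dy mX : ℕ}

/-- The residual `(y_i - A_iᵀ x)_j` as a polynomial in `(ω, x)`. -/
def residForm (y : Fin n → Fin dy → ℝ) (A : Fin n → Matrix (Fin dx) (Fin dy) ℝ) (i : Fin n)
    (j : Fin dy) : MvPolynomial (Fin n ⊕ Fin dx) ℝ :=
  C (y i j) - ∑ k, C (A i k j) * X (Sum.inr k)

/-- The deviation `x_k - x0_k` as a polynomial in `(ω, x)`. -/
def deviation (n : ℕ) (x0 : Fin dx → ℝ) (k : Fin dx) : MvPolynomial (Fin n ⊕ Fin dx) ℝ :=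
  X (Sum.inr k) - C (x0 k)

lemma totalDegree_residForm_le (y : Fin n → Fin dy → ℝ)
    (A : Fin n → Matrix (Fin dx) (Fin dy) ℝ) (i : Fin n) (j : Fin dy) :
    (residForm y A i j).totalDegree ≤ 1 :=
  totalDegree_sub_le' (totalDegree_C_le _ _) (totalDegree_finsetSum_le fun _ _ =>
    totalDegree_mul_le' (totalDegree_C_le _ 0) (totalDegree_X _).le le_rfl)

lemma totalDegree_deviation_le (x0 : Fin dx → ℝ) (k : Fin dx) :
    (deviation n x0 k).totalDegree ≤ 1 :=
  totalDegree_sub_le' (totalDegree_X _).le (totalDegree_C_le _ _)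

lemma aeval_deviation_normAPoly (y : Fin n → Fin dy → ℝ)
    (A : Fin n → Matrix (Fin dx) (Fin dy) ℝ) (x0 : Fin dx → ℝ) (i : Fin n) :
    MvPolynomial.aeval (deviation n x0) (normAPoly A i)
      = ∑ j, (C (y i j - ∑ k, A i k j * x0 k) - residForm y A i j) ^ 2 := by
  simp only [normAPoly, map_sum, map_pow, map_mul, aeval_C, aeval_X, algebraMap_eq, deviation,
    residForm, map_sub]
  refine Finset.sum_congr rfl fun j _ => ?_
  congr 1
  simp only [mul_sub, Finset.sum_sub_distrib]
  ring

variable {y : Fin n → Fin dy → ℝ} {A : Fin n → Matrix (Fin dx) (Fin dy) ℝ}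
  {g : Fin mX → MvPolynomial (Fin dx) ℝ} {cbar : ℝ} {ℓ : ℕ}
  {μ : (Fin n ⊕ Fin dx → ℝ) →₀ ℝ}

lemma PDSatisfies.sos_nonneg (hsat : PDSatisfies μ ℓ (sysM y A g cbar) 0)
    {h : MvPolynomial (Fin n ⊕ Fin dx) ℝ} (hh : IsSOS h) (hd : h.totalDegree ≤ ℓ) :
    0 ≤ expectation μ h := by
  have := hsat ∅ h hh (by simpa using hd)
  simpa [expectation_apply] using this

lemma PDSatisfies.single_nonneg (hsat : PDSatisfies μ ℓ (sysM y A g cbar) 0)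
    {h : MvPolynomial (Fin n ⊕ Fin dx) ℝ} (hh : IsSOS h) (e : Fin n ⊕ Fin n ⊕ Fin n ⊕ Fin mX)
    (hd : h.totalDegree + (sysM y A g cbar e).totalDegree ≤ ℓ) :
    0 ≤ expectation μ (h * sysM y A g cbar e) := by
  have := hsat {e} h hh (by simpa using hd)
  rw [expectation_apply]
  simpa using this

lemma PDSatisfies.measurementFunctional (hsat : PDSatisfies μ ℓ (sysM y A g cbar) 0)
    (i : Fin n) :
    MeasurementFunctional (expectation μ) ℓ (X (Sum.inl i)) (residForm y A i) cbar where
  sq_nonneg f hf := hsat.sos_nonneg (isSOS_sq f) ((totalDegree_pow f 2).trans hf)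
  boolean f hf := by
    have hX : (X (Sum.inl i) : MvPolynomial (Fin n ⊕ Fin dx) ℝ).totalDegree = 1 := totalDegree_X _
    have hX2 : (X (Sum.inl i) ^ 2 : MvPolynomial (Fin n ⊕ Fin dx) ℝ).totalDegree ≤ 2 :=
      (totalDegree_pow _ _).trans (by rw [hX])
    have hf2 := totalDegree_pow f 2
    have h1 := hsat.single_nonneg (isSOS_sq f) (Sum.inl i) (by
      have : (sysM y A g cbar (Sum.inl i)).totalDegree ≤ 2 :=
        totalDegree_sub_le' (by omega) hX2
      omega)
    have h2 := hsat.single_nonneg (isSOS_sq f) (Sum.inr (Sum.inl i)) (by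
      have : (sysM y A g cbar (Sum.inr (Sum.inl i))).totalDegree ≤ 2 :=
        totalDegree_sub_le' hX2 (by omega)
      omega)
    simp only [sysM] at h1 h2
    rw [← neg_sub, mul_neg, map_neg] at h1
    linarith
  resid f hf := by
    have hf2 := totalDegree_pow f 2
    refine hsat.single_nonneg (isSOS_sq f) (Sum.inr (Sum.inr (Sum.inl i))) ?_
    have h2 : (residPoly y A i).totalDegree ≤ 2 := totalDegree_finsetSum_le fun j _ =>
      (totalDegree_pow _ _).trans (by
        have := totalDegree_residForm_le y A i j
        unfold residForm at this
        omega)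
    have : (sysM y A g cbar (Sum.inr (Sum.inr (Sum.inl i)))).totalDegree ≤ 3 :=
      totalDegree_sub_le' (totalDegree_C_le _ _)
        (totalDegree_mul_le' (totalDegree_X _).le h2 le_rfl)
    omega
  degree_selector := (totalDegree_X _).le
  degree_resid := totalDegree_residForm_le y A i

lemma PDSatisfies.ballFunctional (hsat : PDSatisfies μ ℓ (sysM y A g cbar) 0) {Mx : ℝ}
    {j0 : Fin mX} (hj0 : g j0 = C (Mx ^ 2) - vnormPoly dx) {x0 : Fin dx → ℝ}
    (hx0 : ∀ j, 0 ≤ MvPolynomial.eval x0 (g j)) :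
    BallFunctional (expectation μ) ℓ (deviation n x0) (2 * Mx) where
  sos_nonneg h hh hd := hsat.sos_nonneg hh hd
  degree_le := totalDegree_deviation_le x0
  ball h hh hd := by
    have hball : sysM y A g cbar (Sum.inr (Sum.inr (Sum.inr j0)))
        = C (Mx ^ 2) - ∑ k, X (Sum.inr k) ^ 2 := by
      simp [sysM, hj0, vnormPoly]
    have hX : ∀ k : Fin dx,
        (X (Sum.inr k) : MvPolynomial (Fin n ⊕ Fin dx) ℝ).totalDegree = 1 :=
      fun k => totalDegree_X _
    have h1 := hsat.single_nonneg hh (Sum.inr (Sum.inr (Sum.inr j0))) (by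
      have : (sysM y A g cbar (Sum.inr (Sum.inr (Sum.inr j0)))).totalDegree ≤ 2 := by
        rw [hball]
        exact totalDegree_sub_le' (totalDegree_C_le _ _) (totalDegree_finsetSum_le fun k _ =>
          (totalDegree_pow _ _).trans (by rw [hX k]))
      omega)
    rw [hball] at h1
    have h2 : 0 ≤ Mx ^ 2 - ∑ k, x0 k ^ 2 := by
      have := hx0 j0
      rwa [hj0, map_sub, eval_C, eval_vnormPoly] at this
    have h3 := mul_nonneg h2 (hsat.sos_nonneg hh (by omega))
    have h4 : 0 ≤ ∑ k, expectation μ (h * (X (Sum.inr k) + C (x0 k)) ^ 2) := by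
      refine Finset.sum_nonneg fun k _ => hsat.sos_nonneg (hh.mul_sq _) ?_
      have hadd : (X (Sum.inr k) + C (x0 k) : MvPolynomial (Fin n ⊕ Fin dx) ℝ).totalDegree ≤ 1 :=
        totalDegree_add_le' (hX k).le (totalDegree_C_le _ _)
      exact totalDegree_mul_le' le_rfl ((totalDegree_pow _ _).trans
        (by omega : _ ≤ 2)) hd
    have e : h * (C ((2 * Mx) ^ 2) - ∑ k, deviation n x0 k ^ 2)
        = C 2 * (h * (C (Mx ^ 2) - ∑ k, X (Sum.inr k) ^ 2))
          + C 2 * (C (Mx ^ 2 - ∑ k, x0 k ^ 2) * h)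
          + ∑ k, h * (X (Sum.inr k) + C (x0 k)) ^ 2 := by
      have e1 : ∀ k, h * (X (Sum.inr k) + C (x0 k)) ^ 2
          = C 2 * (h * X (Sum.inr k) ^ 2) + C 2 * (C (x0 k ^ 2) * h)
            - h * deviation n x0 k ^ 2 := by
        intro k
        simp only [deviation, map_ofNat, map_pow]; ring
      simp only [e1, Finset.sum_add_distrib, Finset.sum_sub_distrib, ← Finset.mul_sum,
        ← Finset.sum_mul, ← map_sum]
      simp only [map_mul, map_pow, map_sub, map_sum, map_ofNat]
      ring
    rw [e, map_add, map_add, map_sum, map_mvC_mul, map_mvC_mul, map_mvC_mul]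
    linarith

end MeasurementSystem

section Estimate

variable {n dx dy mX : ℕ}

lemma pExpect_single {V : Type*} (z : V → ℝ) (f : (V → ℝ) → ℝ) :
    pExpect (Finsupp.single z 1) f = f z := by
  rw [pExpect, Finsupp.support_single z one_ne_zero]
  simp

lemma isPseudoDist_single {V : Type*} (z : V → ℝ) (ℓ : ℕ) :
    IsPseudoDist (Finsupp.single z 1) ℓ := by
  refine ⟨?_, fun p _ => ?_⟩
  · simp
  · rw [pExpect_single]
    positivity

lemma pdSatisfies_single {V ι : Type*} [Fintype ι] [DecidableEq ι] {z : V → ℝ}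
    {A : ι → MvPolynomial V ℝ} (hA : ∀ i, 0 ≤ eval z (A i)) (ℓ k : ℕ) :
    PDSatisfies (Finsupp.single z 1) ℓ A k := by
  intro S h hh _
  rw [pExpect_single, map_mul, map_prod]
  exact mul_nonneg (hh.eval_nonneg z) (Finset.prod_nonneg fun i _ => hA i)

lemma sum_sq_le_of_enorm_le {d : ℕ} {v : Fin d → ℝ} {c : ℝ} (h : _root_.enorm v ≤ c) :
    ∑ j, v j ^ 2 ≤ c ^ 2 := by
  have h0 : 0 ≤ ∑ j, v j ^ 2 := Finset.sum_nonneg fun j _ => pow_two_nonneg _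
  have h1 : Real.sqrt (∑ j, v j ^ 2) ≤ c := h
  calc ∑ j, v j ^ 2 = Real.sqrt (∑ j, v j ^ 2) ^ 2 := (Real.sq_sqrt h0).symm
    _ ≤ c ^ 2 := pow_le_pow_left₀ (Real.sqrt_nonneg _) h1 2

variable {y : Fin n → Fin dy → ℝ} {A : Fin n → Matrix (Fin dx) (Fin dy) ℝ}
  {g : Fin mX → MvPolynomial (Fin dx) ℝ} {cbar : ℝ} {ℓ : ℕ}
  {μ : (Fin n ⊕ Fin dx → ℝ) →₀ ℝ} {x0 : Fin dx → ℝ} {I : Finset (Fin n)}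

/-- The ground truth with the inlier indicator is feasible for `M_{ω,x}`. -/
lemma sysM_eval_ground_truth_nonneg (hx0 : ∀ j, 0 ≤ MvPolynomial.eval x0 (g j))
    (hinlier : ∀ i ∈ I, ∑ j, (y i j - ∑ k, A i k j * x0 k) ^ 2 ≤ cbar ^ 2)
    (e : Fin n ⊕ Fin n ⊕ Fin n ⊕ Fin mX) :
    0 ≤ eval (Sum.elim (fun i => if i ∈ I then (1 : ℝ) else 0) x0) (sysM y A g cbar e) := by
  rcases e with i | i | i | j
  · by_cases hi : i ∈ I <;> simp [sysM, hi]
  · by_cases hi : i ∈ I <;> simp [sysM, hi]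
  · by_cases hi : i ∈ I
    · simpa [sysM, hi, residPoly] using hinlier i hi
    · simp [sysM, hi, pow_two_nonneg]
  · simp only [sysM, eval_rename]
    exact hx0 j

lemma card_le_of_maximal (hx0 : ∀ j, 0 ≤ MvPolynomial.eval x0 (g j))
    (hinlier : ∀ i ∈ I, ∑ j, (y i j - ∑ k, A i k j * x0 k) ^ 2 ≤ cbar ^ 2)
    (hmax : ∀ ν : (Fin n ⊕ Fin dx → ℝ) →₀ ℝ, IsPseudoDist ν ℓ →
      PDSatisfies ν ℓ (sysM y A g cbar) 0 → ∑ i, Eω ν i ≤ ∑ i, Eω μ i) :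
    (I.card : ℝ) ≤ ∑ i, Eω μ i := by
  have h := hmax _ (isPseudoDist_single _ ℓ)
    (pdSatisfies_single (sysM_eval_ground_truth_nonneg hx0 hinlier) ℓ 0)
  simpa [Eω, pExpect_single] using h

lemma Eω_eq (μ : (Fin n ⊕ Fin dx → ℝ) →₀ ℝ) (i : Fin n) :
    Eω μ i = expectation μ (X (Sum.inl i)) := by
  simp [expectation_apply, Eω]

/-- Definition chase for the estimate: `(∑ Ẽ[ω_j]) (x̂ - x°) = ∑ Ẽ[ω_i (x - x°)]`. -/
lemma sum_mul_xhat_sub (hsat : PDSatisfies μ ℓ (sysM y A g cbar) 0) (hℓ : 2 ≤ ℓ)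
    (hD : ∑ i, Eω μ i ≠ 0) (x0 : Fin dx → ℝ) (k : Fin dx) :
    (∑ i, Eω μ i) * (xhat μ - x0) k
      = ∑ i, expectation μ (X (Sum.inl i) * deviation n x0 k) := by
  have h1 : ∀ i, Eω μ i * vEst μ i k = expectation μ (X (Sum.inl i) * X (Sum.inr k)) := by
    intro i
    have hE : (pExpect μ fun z => z (Sum.inl i) * z (Sum.inr k))
        = expectation μ (X (Sum.inl i) * X (Sum.inr k)) := by
      simp [expectation_apply]
    by_cases hpos : 0 < Eω μ i
    · simp only [vEst, hpos, if_true]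
      rw [mul_inv_cancel_left₀ hpos.ne', hE]
    · have hm := hsat.measurementFunctional i
      have h0 : expectation μ (X (Sum.inl i)) = 0 :=
        le_antisymm (by rw [← Eω_eq]; exact not_lt.mp hpos) (hm.map_selector_nonneg hℓ)
      rw [Eω_eq, h0, zero_mul]
      by_contra hne
      set b := expectation μ (X (Sum.inl i) * X (Sum.inr k)) with hb
      set a := expectation μ (X (Sum.inr k) ^ 2) with ha
      have hcs : ∀ s : ℝ, 0 ≤ 2 * s * b + a := by
        intro s
        have hdeg : (C s * X (Sum.inl i) + X (Sum.inr k) :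
            MvPolynomial (Fin n ⊕ Fin dx) ℝ).totalDegree ≤ 1 :=
          totalDegree_add_le' (totalDegree_mul_le' (totalDegree_C_le s 0)
            (totalDegree_X _).le le_rfl) (totalDegree_X _).le
        have h := hm.sq_nonneg (C s * X (Sum.inl i) + X (Sum.inr k)) (by omega)
        have e : (C s * X (Sum.inl i) + X (Sum.inr k) :
            MvPolynomial (Fin n ⊕ Fin dx) ℝ) ^ 2
            = C (s ^ 2) * X (Sum.inl i) ^ 2 + C (2 * s) * (X (Sum.inl i) * X (Sum.inr k))
              + X (Sum.inr k) ^ 2 := by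
          simp only [map_mul, map_pow, map_ofNat]; ring
        rw [e, map_add, map_add, map_mvC_mul, map_mvC_mul, ← hm.map_selector_eq hℓ, h0] at h
        linarith
      have h := hcs (-(a + 1) / (2 * b))
      have e : 2 * (-(a + 1) / (2 * b)) * b = -(a + 1) := by
        have : b ≠ 0 := fun h => hne h.symm
        field_simp
      linarith
  have h2 : (∑ i, Eω μ i) * xhat μ k = ∑ i, Eω μ i * vEst μ i k := by
    rw [xhat, Finset.mul_sum]
    refine Finset.sum_congr rfl fun i _ => ?_
    rw [← mul_assoc, mul_div_cancel₀ _ hD]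
  rw [Pi.sub_apply, mul_sub, h2, Finset.sum_mul, ← Finset.sum_sub_distrib]
  refine Finset.sum_congr rfl fun i _ => ?_
  rw [h1, deviation, mul_sub, map_sub, mul_comm _ (C (x0 k)), map_mvC_mul, Eω_eq]
  ring

/-- The per-measurement estimates hold with one constant for all certified inliers. -/
lemma exists_inlier_bound (hsat : PDSatisfies μ ℓ (sysM y A g cbar) 0)
    (hE : expectation μ 1 = 1) (hcbar : 0 < cbar) (hdx : 0 < dx) (hI : I.Nonempty)
    (hinlier : ∀ i ∈ I, ∑ j, (y i j - ∑ k, A i k j * x0 k) ^ 2 ≤ cbar ^ 2)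
    {q : Polynomial ℝ} (hq0 : q.eval 0 = 1) {k : ℕ} (hℓ2 : 2 ≤ ℓ) (hk : k ≤ ℓ)
    {B M : ℝ} (hB : 0 < B) (hM : 0 < M) (hδ : 2 * cbar ≠ 1)
    (hcert : ∀ i ∈ I, SosProof (fun _ : Fin 1 => C ((2 * cbar) ^ 2) - normAPoly A i) k
      (Polynomial.aeval (normAPoly A i) q ^ 2 - C ((1 - 2 * cbar) ^ 2)))
    (havg : SosProof (fun _ : Fin 1 => C (M ^ 2) - vnormPoly dx) k
      (C (B ^ 2) - vnormPoly dx *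
        (C ((I.card : ℝ)⁻¹) * ∑ i ∈ I, Polynomial.aeval (normAPoly A i) q ^ 2))) :
    ∃ d, |1 - 2 * cbar| ≤ d ∧ ∀ i ∈ I,
      2 * ((MvPolynomial.aeval (deviation n x0)
        (Polynomial.aeval (normAPoly A i) q)).totalDegree + 1) ≤ ℓ ∧
      ∀ z : MvPolynomial (Fin n ⊕ Fin dx) ℝ, z.totalDegree ≤ 1 →
        (4 ≤ ℓ → expectation μ ((1 - X (Sum.inl i)) * z ^ 2)
          ≤ M ^ 2 * (1 - expectation μ (X (Sum.inl i)))) →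
        2 * B * d * expectation μ (X (Sum.inl i) * z)
          ≤ expectation μ (MvPolynomial.aeval (deviation n x0)
              (Polynomial.aeval (normAPoly A i) q) ^ 2 * z ^ 2) + B ^ 2 := by
  by_cases hA : ∃ i ∈ I, ∃ x, 0 < eval x (normAPoly A i)
  · obtain ⟨i₁, hi₁, x, hx⟩ := hA
    have hdeg : q.natDegree ≠ 0 → 4 * q.natDegree + 2 ≤ ℓ := fun h =>
      (degree_le_of_certificate h hi₁ hx havg).trans hk
    obtain ⟨d, hd, hbound⟩ := exists_uniform_selector_bound (dy := dy) hE hcbar hq0 hℓ2 hdeg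
      (abs_pos.mpr (sub_ne_zero.mpr hδ.symm))
      (weight_ge_of_certificate hq0 hδ hx (hcert i₁ hi₁)) hB
      (fun h => radius_le_of_affine hq0 h hB.le hM hI hdx havg)
    refine ⟨d, hd, fun i hi => ?_⟩
    have hm := hsat.measurementFunctional i
    rw [← Polynomial.aeval_algHom_apply, aeval_deviation_normAPoly y]
    refine ⟨?_, fun z hz hz2 => hbound _ _ _ z hm (hinlier i hi) hz hz2⟩
    have := totalDegree_aeval_le (hm.degree_normSq fun j => y i j - ∑ k, A i k j * x0 k) q
    by_cases h0 : q.natDegree = 0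
    · rw [h0] at this; omega
    · have := hdeg h0; omega
  · push Not at hA
    have hone : ∀ i ∈ I, MvPolynomial.aeval (deviation n x0)
        (Polynomial.aeval (normAPoly A i) q) = 1 := by
      intro i hi
      have h0 : normAPoly A i = 0 := MvPolynomial.funext fun x => by
        rw [map_zero]
        exact le_antisymm (hA i hi x) (eval_normAPoly_nonneg i x)
      rw [← Polynomial.aeval_algHom_apply, h0, map_zero, Polynomial.aeval_def,
        Polynomial.eval₂_at_zero, Polynomial.coeff_zero_eq_eval_zero, hq0, map_one]
    obtain ⟨i₁, hi₁⟩ := hI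
    refine ⟨1, ?_, fun i hi => ?_⟩
    · have h := (hcert i₁ hi₁).eval_nonneg (x := 0) (fun _ => by
        rw [map_sub, eval_C, eval_normAPoly]; simp; positivity)
      rw [map_sub, map_pow, eval_aeval_eq, eval_C, eval_normAPoly] at h
      simp only [Pi.zero_apply, mul_zero, Finset.sum_const_zero, zero_pow two_ne_zero, hq0] at h
      exact abs_le_one_iff_mul_self_le_one.mpr (by nlinarith)
    · rw [hone i hi]
      refine ⟨by simpa using hℓ2, fun z hz _ => ?_⟩
      rw [one_pow, one_mul, mul_one]
      exact (hsat.measurementFunctional i).selector_linear_le_of_const hE hz hℓ2 B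

/-- The total inlier contribution to the estimation error in a unit direction. -/
lemma sum_inlier_le (hsat : PDSatisfies μ ℓ (sysM y A g cbar) 0)
    (hE : expectation μ 1 = 1) (hcbar : 0 < cbar) (hdx : 0 < dx) (hI : I.Nonempty)
    (hinlier : ∀ i ∈ I, ∑ j, (y i j - ∑ k, A i k j * x0 k) ^ 2 ≤ cbar ^ 2)
    {k : ℕ} (hℓ2 : 2 ≤ ℓ) (hk : k ≤ ℓ) {β M Cc : ℝ} (hβ : 0 < β) (hM : 0 < M)
    (hball : BallFunctional (expectation μ) ℓ (deviation n x0) M)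
    (hAC : AntiConcentrated A I k Cc (2 * cbar) M)
    (hK : Cc * (2 * cbar) * M ^ 2 = (1 - 2 * cbar) ^ 2 * β ^ 2)
    {u : Fin dx → ℝ} (hu : ∑ k, u k ^ 2 = 1) :
    ∑ i ∈ I, expectation μ (X (Sum.inl i) * ∑ k, C (u k) * deviation n x0 k)
      ≤ I.card * β := by
  obtain ⟨p, q, hpq, hp0, hcert, havg⟩ := hAC
  have hcard : (0 : ℝ) < I.card := by exact_mod_cast hI.card_pos
  have hq0 : q.eval 0 = 1 := by
    have := hpq 0
    rw [hp0, zero_pow two_ne_zero] at this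
    exact this.symm
  have hKpos := certificate_const_pos hq0 hM hI hdx havg
  have hδ : 2 * cbar ≠ 1 := by
    intro h
    rw [hK, h] at hKpos
    simp at hKpos
  set κ := |1 - 2 * cbar| with hκ
  have hκpos : 0 < κ := abs_pos.mpr (sub_ne_zero.mpr hδ.symm)
  set B := κ * β with hB
  have hBpos : 0 < B := mul_pos hκpos hβ
  rw [show Cc * (2 * cbar) * M ^ 2 = B ^ 2 by rw [hK, hB, mul_pow, hκ, sq_abs]] at havg
  obtain ⟨d, hd, hbound⟩ := exists_inlier_bound hsat hE hcbar hdx hI hinlier hq0 hℓ2 hk hBpos hM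
    hδ hcert havg
  set z := ∑ k, C (u k) * deviation n x0 k with hz
  have hzdeg : z.totalDegree ≤ 1 := totalDegree_finsetSum_le fun k _ =>
    totalDegree_mul_le' (totalDegree_C_le _ 0) (hball.degree_le k) le_rfl
  set P : Fin n → MvPolynomial (Fin n ⊕ Fin dx) ℝ := fun i =>
    MvPolynomial.aeval (deviation n x0) (Polynomial.aeval (normAPoly A i) q) with hP
  have hsum : ∑ i ∈ I, expectation μ (P i ^ 2 * ∑ k, deviation n x0 k ^ 2)
      ≤ I.card * B ^ 2 := by
    have h := hball.sosProof_nonneg hdx hk havg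
    have e : MvPolynomial.aeval (deviation n x0) (C (B ^ 2) - vnormPoly dx *
        (C ((I.card : ℝ)⁻¹) * ∑ i ∈ I, Polynomial.aeval (normAPoly A i) q ^ 2))
        = C (B ^ 2) * 1
          - C ((I.card : ℝ)⁻¹) * ∑ i ∈ I, P i ^ 2 * ∑ k, deviation n x0 k ^ 2 := by
      rw [← Finset.sum_mul, map_sub, map_mul, map_mul, map_sum, aeval_C, aeval_C, algebraMap_eq]
      simp only [map_pow, vnormPoly, map_sum, aeval_X, hP]
      ring
    rw [e, map_sub, map_mvC_mul, map_mvC_mul, hE, map_sum, mul_one, sub_nonneg,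
      inv_mul_le_iff₀ hcard] at h
    exact h
  have hdir : ∀ i ∈ I, 2 * B * d * expectation μ (X (Sum.inl i) * z)
      ≤ expectation μ (P i ^ 2 * ∑ k, deviation n x0 k ^ 2) + B ^ 2 := by
    intro i hi
    obtain ⟨hdeg, hb⟩ := hbound i hi
    have hm := hsat.measurementFunctional i
    have h1 := hb z hzdeg (fun h4 => by
      have hO : (1 - X (Sum.inl i) : MvPolynomial (Fin n ⊕ Fin dx) ℝ).totalDegree ≤ 1 :=
        totalDegree_sub_le' (by simp) hm.degree_selector
      have h2 := hball.direction_le_radius hu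
        (f := (1 - X (Sum.inl i) : MvPolynomial (Fin n ⊕ Fin dx) ℝ)) (by omega)
      have h3 := hm.boolean z (by omega)
      have e1 : (1 - X (Sum.inl i) : MvPolynomial (Fin n ⊕ Fin dx) ℝ) ^ 2 * z ^ 2
          = (1 - X (Sum.inl i)) * z ^ 2
            + z ^ 2 * (X (Sum.inl i) ^ 2 - X (Sum.inl i)) := by ring
      have e2 : (1 - X (Sum.inl i) : MvPolynomial (Fin n ⊕ Fin dx) ℝ) ^ 2
          = 1 - C 2 * X (Sum.inl i) + X (Sum.inl i) ^ 2 := by rw [map_ofNat]; ring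
      rw [← hz, e1, map_add, h3, e2, map_add, map_sub, map_mvC_mul, hE,
        ← hm.map_selector_eq hℓ2] at h2
      linarith)
    exact h1.trans (add_le_add_left (hball.direction_le hu hdeg) _)
  have htot := Finset.sum_le_sum hdir
  rw [← Finset.mul_sum, Finset.sum_add_distrib, Finset.sum_const, nsmul_eq_mul] at htot
  set S := ∑ i ∈ I, expectation μ (X (Sum.inl i) * z)
  by_contra! hlt
  have hS : 0 < S := lt_trans (mul_pos hcard hβ) hlt
  have h1 : 2 * B * (κ * S) ≤ 2 * B * (d * S) := by gcongr
  have h2 : 2 * B * (κ * (I.card * β)) < 2 * B * (κ * S) := by gcongr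
  have h3 : 2 * B * (κ * (I.card * β)) = 2 * (I.card * B ^ 2) := by rw [hB]; ring
  linarith

/-- The outlier contribution of a measurement in a unit direction is at most the radius. -/
lemma expectation_selector_mul_direction_le (hsat : PDSatisfies μ ℓ (sysM y A g cbar) 0)
    (hE : expectation μ 1 = 1) (hℓ : 2 ≤ ℓ) {M : ℝ} (hM : 0 < M)
    (hball : BallFunctional (expectation μ) ℓ (deviation n x0) M)
    {u : Fin dx → ℝ} (hu : ∑ k, u k ^ 2 = 1) (i : Fin n) :
    expectation μ (X (Sum.inl i) * ∑ k, C (u k) * deviation n x0 k) ≤ M := by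
  have hzdeg : (∑ k, C (u k) * deviation n x0 k).totalDegree ≤ 1 :=
    totalDegree_finsetSum_le fun k _ =>
      totalDegree_mul_le' (totalDegree_C_le _ 0) (hball.degree_le k) le_rfl
  have h1 := (hsat.measurementFunctional i).selector_linear_le_of_const hE hzdeg hℓ M
  have h2 := hball.direction_le_radius hu
    (f := (1 : MvPolynomial (Fin n ⊕ Fin dx) ℝ)) (by simpa using hℓ)
  rw [one_pow, one_mul, hE, mul_one] at h2
  refine le_of_mul_le_mul_left ?_ (mul_pos two_pos hM)
  linarith

/-- A total weight at least the number of inliers turns directional bounds on the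
contributions of inliers and outliers into a bound on the estimation error. -/
lemma enorm_xhat_sub_le (hsat : PDSatisfies μ ℓ (sysM y A g cbar) 0) (hℓ : 2 ≤ ℓ)
    (hI : I.Nonempty) (hcard : (I.card : ℝ) ≤ ∑ i, Eω μ i) {β M : ℝ} (hβ : 0 ≤ β) (hM : 0 ≤ M)
    (hin : ∀ u : Fin dx → ℝ, ∑ k, u k ^ 2 = 1 →
      ∑ i ∈ I, expectation μ (X (Sum.inl i) * ∑ k, C (u k) * deviation n x0 k) ≤ I.card * β)
    (hout : ∀ u : Fin dx → ℝ, ∑ k, u k ^ 2 = 1 → ∀ i,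
      expectation μ (X (Sum.inl i) * ∑ k, C (u k) * deviation n x0 k) ≤ M) :
    I.card * _root_.enorm (xhat μ - x0) ≤ I.card * β + (n - I.card) * M := by
  have hIpos : (0 : ℝ) < I.card := by exact_mod_cast hI.card_pos
  have hIn : (I.card : ℝ) ≤ n := by exact_mod_cast card_finset_fin_le I
  set r := _root_.enorm (xhat μ - x0) with hr
  have hr0 : 0 ≤ r := Real.sqrt_nonneg _
  have hrsq : r ^ 2 = ∑ k, (xhat μ - x0) k ^ 2 :=
    Real.sq_sqrt (Finset.sum_nonneg fun k _ => pow_two_nonneg _)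
  rcases hr0.eq_or_lt with h0 | hrpos
  · rw [← h0, mul_zero]
    exact add_nonneg (mul_nonneg hIpos.le hβ) (mul_nonneg (sub_nonneg.mpr hIn) hM)
  set u : Fin dx → ℝ := fun k => (xhat μ - x0) k / r with hu_def
  have hu : ∑ k, u k ^ 2 = 1 := by
    simp only [hu_def, div_pow, ← Finset.sum_div]
    rw [← hrsq, div_self (pow_pos hrpos 2).ne']
  have hru : ∑ k, u k * (xhat μ - x0) k = r := by
    have e : ∀ k, u k * (xhat μ - x0) k = (xhat μ - x0) k ^ 2 / r := fun k => by
      simp only [hu_def]; ring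
    simp only [e, ← Finset.sum_div]
    rw [← hrsq, pow_two, mul_div_cancel_right₀ _ hrpos.ne']
  have hD : ∑ i, Eω μ i ≠ 0 := (hIpos.trans_le hcard).ne'
  have htot : (∑ i, Eω μ i) * r
      = ∑ i, expectation μ (X (Sum.inl i) * ∑ k, C (u k) * deviation n x0 k) := by
    have e : ∀ i : Fin n, expectation μ (X (Sum.inl i) * ∑ k, C (u k) * deviation n x0 k)
        = ∑ k, u k * expectation μ (X (Sum.inl i) * deviation n x0 k) := fun i => by
      rw [Finset.mul_sum, map_sum]
      exact Finset.sum_congr rfl fun k _ => by rw [mul_left_comm, map_mvC_mul]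
    simp only [e]
    rw [Finset.sum_comm, ← hru, Finset.mul_sum]
    refine Finset.sum_congr rfl fun k _ => ?_
    rw [← Finset.mul_sum, ← sum_mul_xhat_sub hsat hℓ hD, mul_left_comm]
  have hcompl : ∑ i ∈ Iᶜ, expectation μ (X (Sum.inl i) * ∑ k, C (u k) * deviation n x0 k)
      ≤ (n - I.card) * M := by
    refine (Finset.sum_le_card_nsmul _ _ _ fun i _ => hout u hu i).trans (le_of_eq ?_)
    rw [nsmul_eq_mul, Finset.card_compl, Fintype.card_fin,
      Nat.cast_sub (card_finset_fin_le I)]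
  calc I.card * r ≤ (∑ i, Eω μ i) * r := mul_le_mul_of_nonneg_right hcard hr0
    _ = _ := htot
    _ = _ := (Finset.sum_add_sum_compl I _).symm
    _ ≤ _ := add_le_add (hin u hu) hcompl

end Estimate

/-- A priori estimation contract for the moment relaxation of (MC1): under
certifiable anti-concentration of the inliers, any level-`ℓ` pseudo-distribution
(`ℓ ≥ k`) satisfying `M_{ω,x}` at degree `0` and maximizing `∑_i Ẽ[ω_i]` yields
an estimate `x̂` with `‖x̂ − x°‖ ≤ α·η·M_x/2 + 2·M_x·(1−α)/α`. -/
theorem mc_a_priori_contract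
    {n dx dy mX : ℕ} (hn : 0 < n) (hdx : 0 < dx) (hdy : 0 < dy)
    (y : Fin n → Fin dy → ℝ) (A : Fin n → Matrix (Fin dx) (Fin dy) ℝ)
    (g : Fin mX → MvPolynomial (Fin dx) ℝ)
    (Mx : ℝ) (hMx : 0 < Mx)
    (j0 : Fin mX) (hj0 : g j0 = C (Mx ^ 2) - vnormPoly dx)
    (x0 : Fin dx → ℝ) (hx0 : ∀ j, 0 ≤ MvPolynomial.eval x0 (g j))
    (cbar : ℝ) (hcbar : 0 < cbar)
    (α : ℝ) (hα0 : 0 < α) (hα1 : α ≤ 1)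
    (I : Finset (Fin n)) (hIcard : (I.card : ℝ) = α * n)
    (hinlier : ∀ i ∈ I, _root_.enorm (fun j => y i j - ∑ k, A i k j * x0 k) ≤ cbar)
    (η : ℝ) (hη : 0 < η)
    (k : ℕ) (hk : 0 < k) (hke : Even k)
    (hAC : AntiConcentrated A I k
      (α ^ 2 * η ^ 2 * (1 - 2 * cbar) ^ 2 / (32 * cbar)) (2 * cbar) (2 * Mx))
    (ℓ : ℕ) (hℓ : k ≤ ℓ)
    (μ : (Fin n ⊕ Fin dx → ℝ) →₀ ℝ)
    (hpd : IsPseudoDist μ ℓ)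
    (hsat : PDSatisfies μ ℓ (sysM y A g cbar) 0)
    (hmax : ∀ ν : (Fin n ⊕ Fin dx → ℝ) →₀ ℝ, IsPseudoDist ν ℓ →
      PDSatisfies ν ℓ (sysM y A g cbar) 0 → ∑ i, Eω ν i ≤ ∑ i, Eω μ i) :
    _root_.enorm (xhat μ - x0) ≤ α * η * Mx / 2 + 2 * Mx * (1 - α) / α := by
  have hE : expectation μ 1 = 1 := by
    rw [expectation_apply, ← hpd.1]
    simp [pExpect]
  have hℓ2 : 2 ≤ ℓ := by obtain ⟨m, rfl⟩ := hke; omega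
  have hn' : (0 : ℝ) < n := by exact_mod_cast hn
  have hIpos : (0 : ℝ) < I.card := hIcard ▸ mul_pos hα0 hn'
  have hI : I.Nonempty := Finset.card_pos.mp (by exact_mod_cast hIpos)
  have hin : ∀ i ∈ I, ∑ j, (y i j - ∑ k, A i k j * x0 k) ^ 2 ≤ cbar ^ 2 :=
    fun i hi => sum_sq_le_of_enorm_le (hinlier i hi)
  have hβ : 0 < α * η * Mx / 2 := by positivity
  have hM : 0 < 2 * Mx := by positivity
  have hball := hsat.ballFunctional hj0 hx0
  have h := enorm_xhat_sub_le hsat hℓ2 hI (card_le_of_maximal hx0 hin hmax) hβ.le hM.le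
    (fun u hu => sum_inlier_le hsat hE hcbar hdx hI hin hℓ2 hℓ hβ hM hball hAC
      (by field_simp; ring) hu)
    (fun u hu i => expectation_selector_mul_direction_le hsat hE hℓ2 hM hball hu i)
  refine le_of_mul_le_mul_left (h.trans (le_of_eq ?_)) hIpos
  rw [hIcard]
  field_simp
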